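/- arXiv:1411.4819 — 3 statements merged into one kernel-verified Lean document; each statement's English description precedes it below -/
import Mathlib

section
/- Let G be a 3-connected graph, let v be a vertex of G, let x and y be two distinct neighbors of v in G, and let C be a cycle in the graph G−v obtained from G by deleting v. Then G contains a subgraph that is a K4-subdivision, contains the cycle C as a subgraph, contains the edges vx and vy, and has v as one of its real vertices. -/
open SimpleGraph

variable {V : Type*}

/-- A graph is `k`-connected if it has more than `k` vertices and no set of fewer than `k`
vertices whose deletion leaves a disconnected graph. -/
def IsKConnected [Fintype V] (k : ℕ) (G : SimpleGraph V) : Prop :=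
  k < Fintype.card V ∧
    ∀ S : Finset V, S.card < k → (G.induce ((↑S : Set V)ᶜ)).Connected

/-- `H` is a subgraph of `G` that is a cycle. -/
def IsCycleSubgraph {G : SimpleGraph V} (H : G.Subgraph) : Prop :=
  ∃ (u : V) (c : G.Walk u u), c.IsCycle ∧ H = c.toSubgraph

/-- `H` is a `K₄`-subdivision of `G` with branch ("real") vertices `b 0, b 1, b 2, b 3`:
there are six paths of length at least one in `G`, one between each pair of branch
vertices, whose union is `H`, such that any two of these paths intersect exactly in
their common endpoints (in particular they are internally disjoint from each other and
from the branch vertices). -/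
def IsK4SubdivisionOn {G : SimpleGraph V} (H : G.Subgraph) (b : Fin 4 → V) : Prop :=
  Function.Injective b ∧
  ∃ P : ∀ p : Fin 4 × Fin 4, p.1 < p.2 → G.Walk (b p.1) (b p.2),
    (∀ p h, (P p h).IsPath) ∧
    (∀ p h, 0 < (P p h).length) ∧
    (H = ⨆ (p : Fin 4 × Fin 4) (h : p.1 < p.2), (P p h).toSubgraph) ∧
    (∀ p q hp hq, p ≠ q → ∀ x, x ∈ (P p hp).support → x ∈ (P q hq).support →
      x ∈ ({b p.1, b p.2} ∩ {b q.1, b q.2} : Set V))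

/-- `H` is a subgraph of `G` that is a `K₄`-subdivision. -/
def IsK4Subdivision {G : SimpleGraph V} (H : G.Subgraph) : Prop :=
  ∃ b, IsK4SubdivisionOn H b

section Linkage

variable {G : SimpleGraph V}

open Classical in
/-- A set `U` together with all neighbours of its elements. -/
noncomputable def closedNbhd [Fintype V] (G : SimpleGraph V) (U : Finset V) : Finset V :=
  Finset.univ.filter fun w => ∃ u ∈ U, u = w ∨ G.Adj u w

theorem mem_closedNbhd [Fintype V] {U : Finset V} {w : V} :
    w ∈ closedNbhd G U ↔ ∃ u ∈ U, u = w ∨ G.Adj u w := by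
  simp [closedNbhd]

theorem SimpleGraph.Reachable.mem_of_forall_adj {W : Type*} {K : SimpleGraph W} {U : Set W}
    (hU : ∀ a ∈ U, ∀ b, K.Adj a b → b ∈ U) {a b : W} (h : K.Reachable a b) (ha : a ∈ U) :
    b ∈ U := by
  obtain ⟨p⟩ := h
  induction p with
  | nil => exact ha
  | cons hadj _ ih => exact ih (hU _ ha _ hadj)

/-- In a `k`-connected graph, a nonempty set that misses some `k` vertices has at least `k`
outer neighbours. -/
theorem IsKConnected.card_add_le_card_closedNbhd [Fintype V] {k : ℕ} (hG : IsKConnected k G)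
    {U A : Finset V} (hU : U.Nonempty) (hA : k ≤ A.card) (hUA : Disjoint U A) :
    U.card + k ≤ (closedNbhd G U).card := by
  classical
  have hsub : U ⊆ closedNbhd G U := fun u hu => mem_closedNbhd.2 ⟨u, hu, Or.inl rfl⟩
  by_contra! hlt
  set T := closedNbhd G U \ U with hT
  have hTcard : T.card < k := by
    have := Finset.card_sdiff_add_card_eq_card hsub
    rw [← hT] at this
    omega
  obtain ⟨a, haA, haT⟩ := Finset.exists_mem_notMem_of_card_lt_card (hTcard.trans_le hA)
  obtain ⟨u, hu⟩ := hU
  have huT : u ∉ T := by simp [hT, hu]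
  have hreach := (hG.2 T hTcard).preconnected ⟨u, by simpa using huT⟩ ⟨a, by simpa using haT⟩
  have haU : a ∈ U := by
    refine SimpleGraph.Reachable.mem_of_forall_adj
      (U := {w : ((↑T : Set V)ᶜ : Set V) | (w : V) ∈ U}) ?_ hreach hu
    rintro ⟨c, hc⟩ hcU ⟨d, hd⟩ hcd
    by_contra hdU
    exact hd (Finset.mem_coe.2 (Finset.mem_sdiff.2
      ⟨mem_closedNbhd.2 ⟨c, hcU, Or.inr hcd⟩, hdU⟩))
  exact Finset.disjoint_left.1 hUA haU haA

theorem exists_walk_support_eq_map_iterate (g : V → V) (s : V) (n : ℕ)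
    (h : ∀ i < n, G.Adj (g^[i] s) (g^[i + 1] s)) :
    ∃ w : G.Walk s (g^[n] s), w.support = (List.range (n + 1)).map fun i => g^[i] s := by
  induction n with
  | zero => exact ⟨Walk.nil, by simp⟩
  | succ n ih =>
    obtain ⟨w, hw⟩ := ih fun i hi => h i (by omega)
    refine ⟨w.concat (h n (by omega)), ?_⟩
    rw [Walk.support_concat, hw, List.range_succ (n := n + 1)]
    simp

/-- Two orbits of a map that is injective outside `A`, started outside its image, do not meet
before they enter `A`. -/
theorem eq_of_iterate_eq {g : V → V} {A : Set V} (hg : Set.InjOn g Aᶜ) {s t : V}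
    (hs : s ∉ g '' Aᶜ) (ht : t ∉ g '' Aᶜ) {i j : ℕ} (hi : ∀ k < i, g^[k] s ∉ A)
    (hj : ∀ k < j, g^[k] t ∉ A) (h : g^[i] s = g^[j] t) : s = t ∧ i = j := by
  induction i generalizing j with
  | zero =>
    cases j with
    | zero => exact ⟨h, rfl⟩
    | succ j =>
      refine absurd ⟨g^[j] t, hj j (by omega), ?_⟩ hs
      rw [← Function.iterate_succ_apply' g, ← h, Function.iterate_zero, id]
  | succ i ih =>
    cases j with
    | zero =>
      refine absurd ⟨g^[i] s, hi i (by omega), ?_⟩ ht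
      rw [← Function.iterate_succ_apply' g, h, Function.iterate_zero, id]
    | succ j =>
      rw [Function.iterate_succ_apply', Function.iterate_succ_apply'] at h
      obtain ⟨h₁, h₂⟩ := ih (fun k hk => hi k (by omega)) (fun k hk => hj k (by omega))
        (hg (hi i (by omega)) (hj j (by omega)) h)
      exact ⟨h₁, by omega⟩

theorem exists_first_iterate_mem [Finite V] {g : V → V} {A : Set V} (hg : Set.InjOn g Aᶜ) {s : V}
    (hs : s ∉ g '' Aᶜ) : ∃ n, g^[n] s ∈ A ∧ ∀ k < n, g^[k] s ∉ A := by
  classical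
  have hex : ∃ n, g^[n] s ∈ A := by
    by_contra! hn
    exact not_injective_infinite_finite (fun n => g^[n] s) fun i j hij =>
      (eq_of_iterate_eq hg hs hs (fun k _ => hn k) (fun k _ => hn k) hij).2
  exact ⟨Nat.find hex, Nat.find_spec hex, fun k hk => Nat.find_min hex hk⟩

/-- If every nonempty set `U` disjoint from `A` has at least `|S|` outer neighbours, then `S` can be
joined to `A` by disjoint paths. -/
theorem exists_disjoint_paths [Fintype V] (S A : Finset V)
    (hSA : ∀ U : Finset V, U.Nonempty → Disjoint U A → U.card + S.card ≤ (closedNbhd G U).card) :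
    ∃ (e : V → V) (w : ∀ s, G.Walk s (e s)), ∀ s ∈ S, e s ∈ A ∧ (w s).IsPath ∧
      (∀ u ∈ (w s).support, u ∈ A → u = e s) ∧
      ∀ t ∈ S, ∀ u, u ∈ (w s).support → u ∈ (w t).support → s = t := by
  classical
  obtain ⟨f, hf, hft⟩ := (Finset.all_card_le_biUnion_card_iff_exists_injective
      (fun u : {u : V // u ∉ A} => closedNbhd G {(u : V)} \ S)).1 <| by
    intro U
    obtain rfl | hU := U.eq_empty_or_nonempty
    · simp
    have h := hSA (U.map (Function.Embedding.subtype _)) hU.map <| by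
      rw [Finset.disjoint_left]
      simp only [Finset.mem_map]
      rintro _ ⟨u, -, rfl⟩
      exact u.2
    have hsub : closedNbhd G (U.map (Function.Embedding.subtype _)) \ S ⊆
        U.biUnion fun u => closedNbhd G {(u : V)} \ S := by
      intro w
      simp only [Finset.mem_sdiff, mem_closedNbhd, Finset.mem_biUnion, Finset.mem_map]
      rintro ⟨⟨_, ⟨u, hu, rfl⟩, huw⟩, hw⟩
      exact ⟨u, hu, ⟨u, by simp, huw⟩, hw⟩
    have h₁ := Finset.card_le_card hsub
    have h₂ := Finset.le_card_sdiff S (closedNbhd G (U.map (Function.Embedding.subtype _)))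
    rw [Finset.card_map] at h
    omega
  let g : V → V := fun u => if h : u ∉ A then f ⟨u, h⟩ else u
  have hgf : ∀ u (h : u ∉ A), g u = f ⟨u, h⟩ := fun u h => dif_pos h
  have hg : Set.InjOn g (↑A : Set V)ᶜ := by
    intro a ha b hb hab
    rw [hgf a ha, hgf b hb] at hab
    exact congrArg Subtype.val (hf hab)
  have hgS : ∀ s ∈ S, s ∉ g '' (↑A : Set V)ᶜ := by
    rintro _ hs ⟨u, hu, rfl⟩
    rw [hgf u hu] at hs
    exact (Finset.mem_sdiff.1 (hft ⟨u, hu⟩)).2 hs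
  have hgadj : ∀ u ∉ A, u = g u ∨ G.Adj u (g u) := by
    intro u hu
    have := mem_closedNbhd.1 (Finset.mem_sdiff.1 (hft ⟨u, hu⟩)).1
    rw [hgf u hu]
    simpa using this
  have key : ∀ s, ∃ (e : V) (w : G.Walk s e), s ∈ S → e ∈ A ∧ w.IsPath ∧
      (∀ u ∈ w.support, u ∈ A → u = e) ∧
      ∀ u ∈ w.support, ∃ i, u = g^[i] s ∧ ∀ k < i, g^[k] s ∉ A := by
    intro s
    by_cases hs : s ∈ S
    swap
    · exact ⟨s, Walk.nil, fun h => absurd h hs⟩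
    obtain ⟨n, hnA, hn⟩ := exists_first_iterate_mem hg (hgS s hs)
    have hinj : ∀ i ≤ n, ∀ j ≤ n, g^[i] s = g^[j] s → i = j := fun i hi j hj hij =>
      (eq_of_iterate_eq hg (hgS s hs) (hgS s hs) (fun k hk => hn k (by omega))
        (fun k hk => hn k (by omega)) hij).2
    obtain ⟨w, hw⟩ := exists_walk_support_eq_map_iterate (G := G) g s n <| by
      intro i hi
      rw [Function.iterate_succ_apply']
      refine (hgadj _ (hn i hi)).resolve_left fun h => ?_
      rw [← Function.iterate_succ_apply' g] at h
      have := hinj i (by omega) (i + 1) (by omega) h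
      omega
    refine ⟨_, w, fun _ => ⟨hnA, ?_, ?_, ?_⟩⟩
    · rw [Walk.isPath_def, hw]
      refine List.Nodup.map_on (fun i hi j hj hij => ?_) List.nodup_range
      rw [List.mem_range] at hi hj
      exact hinj i (by omega) j (by omega) hij
    · intro u hu huA
      rw [hw, List.mem_map] at hu
      obtain ⟨i, hi, rfl⟩ := hu
      rw [List.mem_range] at hi
      obtain rfl : i = n := by
        by_contra hne
        exact hn i (by omega) huA
      rfl
    · intro u hu
      rw [hw, List.mem_map] at hu
      obtain ⟨i, hi, rfl⟩ := hu
      rw [List.mem_range] at hi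
      exact ⟨i, rfl, fun k hk => hn k (by omega)⟩
  choose e w hew using key
  refine ⟨e, w, fun s hs => ?_⟩
  obtain ⟨h₁, h₂, h₃, h₄⟩ := hew s hs
  refine ⟨h₁, h₂, h₃, fun t ht u hus hut => ?_⟩
  obtain ⟨i, rfl, hi⟩ := h₄ u hus
  obtain ⟨j, hij, hj⟩ := (hew t ht).2.2.2 _ hut
  exact (eq_of_iterate_eq hg (hgS s hs) (hgS t ht) hi hj hij).1

end Linkage

section Cycle

variable {G : SimpleGraph V}

/-- `p`, `q`, `r` are three paths that meet only in common endpoints and form the cycle `C`. -/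
structure IsTriangleSplit {a b c : V} (C : G.Subgraph) (p : G.Walk a b) (q : G.Walk b c)
    (r : G.Walk a c) : Prop where
  isPath_left : p.IsPath
  isPath_mid : q.IsPath
  isPath_right : r.IsPath
  toSubgraph_eq : C = p.toSubgraph ⊔ q.toSubgraph ⊔ r.toSubgraph
  left_mid : ∀ u ∈ p.support, u ∈ q.support → u = b
  mid_right : ∀ u ∈ q.support, u ∈ r.support → u = c
  left_right : ∀ u ∈ p.support, u ∈ r.support → u = a

theorem IsTriangleSplit.reverse {a b c : V} {C : G.Subgraph} {p : G.Walk a b} {q : G.Walk b c}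
    {r : G.Walk a c} (h : IsTriangleSplit C p q r) : IsTriangleSplit C r q.reverse p where
  isPath_left := h.isPath_right
  isPath_mid := h.isPath_mid.reverse
  isPath_right := h.isPath_left
  toSubgraph_eq := by
    rw [h.toSubgraph_eq, Walk.toSubgraph_reverse, sup_right_comm, sup_comm p.toSubgraph,
      sup_right_comm]
  left_mid u hr hq := h.mid_right u (by simpa using hq) hr
  mid_right u hq hp := h.left_mid u hp (by simpa using hq)
  left_right u hr hp := h.left_right u hp hr

theorem isTriangleSplit_of_isCycle {a b c : V} {p : G.Walk a b} {q : G.Walk b c} {r : G.Walk c a}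
    (hab : a ≠ b) (hbc : b ≠ c) (hca : c ≠ a) (h : (p.append (q.append r)).IsCycle) :
    IsTriangleSplit (p.append (q.append r)).toSubgraph p q r.reverse := by
  have hp : b ∈ p.support.tail := Walk.end_mem_tail_support_of_ne hab p
  have hq : c ∈ q.support.tail := Walk.end_mem_tail_support_of_ne hbc q
  have hr : a ∈ r.support.tail := Walk.end_mem_tail_support_of_ne hca r
  have hnd := h.support_nodup
  rw [Walk.tail_support_append, Walk.tail_support_append] at hnd
  obtain ⟨np, nqr, dp⟩ := List.nodup_append'.1 hnd
  obtain ⟨nq, nr, dqr⟩ := List.nodup_append'.1 nqr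
  rw [List.disjoint_append_right] at dp
  obtain ⟨dpq, dpr⟩ := dp
  rw [List.disjoint_left] at dpq dpr dqr
  constructor
  · rw [Walk.isPath_def, ← Walk.cons_tail_support, List.nodup_cons]
    exact ⟨fun ha => dpr ha hr, np⟩
  · rw [Walk.isPath_def, ← Walk.cons_tail_support, List.nodup_cons]
    exact ⟨fun hb => dpq hp hb, nq⟩
  · rw [Walk.isPath_reverse_iff, Walk.isPath_def, ← Walk.cons_tail_support, List.nodup_cons]
    exact ⟨fun hc => dqr hq hc, nr⟩
  · rw [Walk.toSubgraph_append, Walk.toSubgraph_append, Walk.toSubgraph_reverse, sup_assoc]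
  all_goals
    intro u h₁ h₂
    simp only [Walk.support_reverse, List.mem_reverse, Walk.mem_support_iff] at h₁ h₂
    grind

theorem exists_isTriangleSplit {C : G.Subgraph} (hC : IsCycleSubgraph C) {a b c : V}
    (ha : a ∈ C.verts) (hb : b ∈ C.verts) (hc : c ∈ C.verts) (hab : a ≠ b) (hbc : b ≠ c)
    (hca : c ≠ a) :
    ∃ (p : G.Walk a b) (q : G.Walk b c) (r : G.Walk a c), IsTriangleSplit C p q r := by
  classical
  obtain ⟨o, d₀, hd₀, rfl⟩ := hC
  rw [Walk.mem_verts_toSubgraph] at ha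
  have hd := hd₀.rotate ha
  rw [← Walk.toSubgraph_rotate d₀ ha] at hb hc ⊢
  generalize d₀.rotate a ha = d at *
  rw [Walk.mem_verts_toSubgraph] at hb hc
  have hspec := d.take_spec hb
  rw [← hspec, Walk.mem_support_append_iff] at hc
  rcases hc with hc | hc
  · have h₂ := (d.takeUntil b hb).take_spec hc
    rw [← h₂, ← Walk.append_assoc] at hspec
    rw [← hspec] at hd ⊢
    exact ⟨_, _, _, (isTriangleSplit_of_isCycle hca.symm hbc.symm hab.symm hd).reverse⟩
  · have h₂ := (d.dropUntil b hb).take_spec hc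
    rw [← h₂] at hspec
    rw [← hspec] at hd ⊢
    exact ⟨_, _, _, isTriangleSplit_of_isCycle hab hbc hca hd⟩

theorem IsCycleSubgraph.exists_finset {C : G.Subgraph} (hC : IsCycleSubgraph C) :
    ∃ A : Finset V, 3 ≤ A.card ∧ ∀ u, u ∈ A ↔ u ∈ C.verts := by
  classical
  obtain ⟨o, d, hd, rfl⟩ := hC
  refine ⟨d.support.toFinset, ?_, fun u => by simp⟩
  have hsub : d.support.tail.toFinset ⊆ d.support.toFinset := fun u hu => by
    rw [List.mem_toFinset] at hu ⊢
    exact List.mem_of_mem_tail hu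
  have h₁ := Finset.card_le_card hsub
  rw [List.toFinset_card_of_nodup hd.support_nodup] at h₁
  have h₂ := hd.three_le_length
  simp at h₁
  omega

end Cycle

/-- A cycle split into three paths, together with three paths from a vertex `v` to the branch
vertices on the cycle, forms a `K₄`-subdivision. -/
theorem exists_isK4SubdivisionOn {G : SimpleGraph V} {C : G.Subgraph} {v a b c : V}
    {p : G.Walk a b} {q : G.Walk b c} {r : G.Walk a c} (hC : IsTriangleSplit C p q r)
    (hv : v ∉ C.verts) (hab : a ≠ b) (hbc : b ≠ c) (hca : c ≠ a)
    {α : G.Walk v a} {β : G.Walk v b} {γ : G.Walk v c}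
    (hα : α.IsPath) (hβ : β.IsPath) (hγ : γ.IsPath)
    (hαC : ∀ u ∈ α.support, u ∈ C.verts → u = a) (hβC : ∀ u ∈ β.support, u ∈ C.verts → u = b)
    (hγC : ∀ u ∈ γ.support, u ∈ C.verts → u = c)
    (hαβ : ∀ u ∈ α.support, u ∈ β.support → u = v) (hβγ : ∀ u ∈ β.support, u ∈ γ.support → u = v)
    (hαγ : ∀ u ∈ α.support, u ∈ γ.support → u = v) :
    ∃ H : G.Subgraph, IsK4SubdivisionOn H ![v, a, b, c] ∧ C ≤ H ∧ α.toSubgraph ≤ H ∧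
      β.toSubgraph ≤ H ∧ γ.toSubgraph ≤ H := by
  have hpC : ∀ u ∈ p.support, u ∈ C.verts := fun u hu => by simp [hC.toSubgraph_eq, hu]
  have hqC : ∀ u ∈ q.support, u ∈ C.verts := fun u hu => by simp [hC.toSubgraph_eq, hu]
  have hrC : ∀ u ∈ r.support, u ∈ C.verts := fun u hu => by simp [hC.toSubgraph_eq, hu]
  have hva : v ≠ a := fun h => hv (h ▸ hpC a p.start_mem_support)
  have hvb : v ≠ b := fun h => hv (h ▸ hpC b p.end_mem_support)
  have hvc : v ≠ c := fun h => hv (h ▸ hqC c q.end_mem_support)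
  let B : Fin 4 → V := ![v, a, b, c]
  obtain ⟨P, h01, h02, h03, h12, h13, h23⟩ :
      ∃ P : ∀ p : Fin 4 × Fin 4, p.1 < p.2 → G.Walk (B p.1) (B p.2),
        P (0, 1) (by decide) = α ∧ P (0, 2) (by decide) = β ∧ P (0, 3) (by decide) = γ ∧
        P (1, 2) (by decide) = p ∧ P (1, 3) (by decide) = r ∧ P (2, 3) (by decide) = q :=
    ⟨fun i h => match i, h with
      | (⟨0, _⟩, ⟨1, _⟩), _ => α
      | (⟨0, _⟩, ⟨2, _⟩), _ => β
      | (⟨0, _⟩, ⟨3, _⟩), _ => γ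
      | (⟨1, _⟩, ⟨2, _⟩), _ => p
      | (⟨1, _⟩, ⟨3, _⟩), _ => r
      | (⟨2, _⟩, ⟨3, _⟩), _ => q
      | (⟨k + 3, _⟩, ⟨l, _⟩), h => absurd (Fin.lt_def.1 h) (by dsimp only; omega),
      rfl, rfl, rfl, rfl, rfl, rfl⟩
  have hcases : ∀ i : Fin 4 × Fin 4, i.1 < i.2 →
      i = (0, 1) ∨ i = (0, 2) ∨ i = (0, 3) ∨ i = (1, 2) ∨ i = (1, 3) ∨ i = (2, 3) := by
    decide
  have hB : Function.Injective B := by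
    intro i j hij
    fin_cases i <;> fin_cases j <;> first
      | rfl
      | exact absurd hij ‹_›
      | exact absurd hij.symm ‹_›
  have hle : ∀ i h, (P i h).toSubgraph ≤
      ⨆ (i : Fin 4 × Fin 4) (h : i.1 < i.2), (P i h).toSubgraph :=
    fun i h => le_iSup₂_of_le i h le_rfl
  have h₁ := hC.left_mid
  have h₂ := hC.mid_right
  have h₃ := hC.left_right
  have haq : a ∉ q.support := fun h => hab (h₁ a p.start_mem_support h)
  have hbr : b ∉ r.support := fun h => hab (h₃ b p.end_mem_support h).symm
  have hcp : c ∉ p.support := fun h => hca (h₃ c h r.end_mem_support)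
  refine ⟨⨆ (i : Fin 4 × Fin 4) (h : i.1 < i.2), (P i h).toSubgraph,
    ⟨hB, P, ?_, ?_, rfl, ?_⟩, ?_, h01 ▸ hle (0, 1) _, h02 ▸ hle (0, 2) _, h03 ▸ hle (0, 3) _⟩
  · intro i h
    rcases hcases i h with rfl | rfl | rfl | rfl | rfl | rfl
    exacts [h01 ▸ hα, h02 ▸ hβ, h03 ▸ hγ, h12 ▸ hC.isPath_left, h13 ▸ hC.isPath_right,
      h23 ▸ hC.isPath_mid]
  · intro i h
    rw [Nat.pos_iff_ne_zero]
    intro h0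
    exact h.ne (hB (Walk.eq_of_length_eq_zero h0))
  · intro i j hi hj hne u hu hu'
    have s01 : ∀ h, (P (0, 1) h).support = α.support := fun _ => congrArg Walk.support h01
    have s02 : ∀ h, (P (0, 2) h).support = β.support := fun _ => congrArg Walk.support h02
    have s03 : ∀ h, (P (0, 3) h).support = γ.support := fun _ => congrArg Walk.support h03
    have s12 : ∀ h, (P (1, 2) h).support = p.support := fun _ => congrArg Walk.support h12
    have s13 : ∀ h, (P (1, 3) h).support = r.support := fun _ => congrArg Walk.support h13
    have s23 : ∀ h, (P (2, 3) h).support = q.support := fun _ => congrArg Walk.support h23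
    clear hle hC hB
    rcases hcases i hi with rfl | rfl | rfl | rfl | rfl | rfl <;>
    rcases hcases j hj with rfl | rfl | rfl | rfl | rfl | rfl <;>
    first
    | exact absurd rfl hne
    | simp only [s01, s02, s03, s12, s13, s23] at hu hu'
      simp only [Set.mem_inter_iff, Set.mem_insert_iff, Set.mem_singleton_iff, Matrix.cons_val]
      clear h01 h02 h03 h12 h13 h23 s01 s02 s03 s12 s13 s23 hcases hi hj hne
      grind
  · rw [hC.toSubgraph_eq]
    exact sup_le (sup_le (h12 ▸ hle (1, 2) _) (h23 ▸ hle (2, 3) _)) (h13 ▸ hle (1, 3) _)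

/-- Let `G` be a 3-connected graph, `v` a vertex of `G`, `x ≠ y` two
neighbors of `v`, and `C` a cycle of `G - v`. Then `G` contains a `K₄`-subdivision that
contains `C` as a subgraph, contains the edges `vx` and `vy`, and has `v` as a real
vertex. -/
theorem stmt7 [Fintype V] {G : SimpleGraph V} (hG : IsKConnected 3 G) (v x y : V)
    (hxy : x ≠ y) (hx : G.Adj v x) (hy : G.Adj v y)
    (C : G.Subgraph) (hC : IsCycleSubgraph C) (hv : v ∉ C.verts) :
    ∃ (H : G.Subgraph) (b : Fin 4 → V),
      IsK4SubdivisionOn H b ∧ C ≤ H ∧ H.Adj v x ∧ H.Adj v y ∧ v ∈ Set.range b := by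
  classical
  obtain ⟨A, hA3, hA⟩ := hC.exists_finset
  obtain ⟨e, w, hew⟩ := exists_disjoint_paths (G := G) {v, x, y} A fun U hU hUA => by
    refine le_trans ?_ (hG.card_add_le_card_closedNbhd hU hA3 hUA)
    exact Nat.add_le_add_left Finset.card_le_three _
  simp only [hA] at hew
  have hdisj : ∀ s ∈ ({v, x, y} : Finset V), ∀ t ∈ ({v, x, y} : Finset V), s ≠ t →
      ∀ u ∈ (w s).support, u ∉ (w t).support := fun s hs t ht hst u hus hut =>
    hst ((hew s hs).2.2.2 t ht u hus hut)
  have hne : ∀ s ∈ ({v, x, y} : Finset V), ∀ t ∈ ({v, x, y} : Finset V), s ≠ t → e s ≠ e t :=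
    fun s hs t ht hst h =>
      hdisj s hs t ht hst (e s) (w s).end_mem_support (by rw [h]; exact (w t).end_mem_support)
  have mv : v ∈ ({v, x, y} : Finset V) := by simp
  have mx : x ∈ ({v, x, y} : Finset V) := by simp
  have my : y ∈ ({v, x, y} : Finset V) := by simp
  obtain ⟨ev, pv, cv, -⟩ := hew v mv
  obtain ⟨ex, px, cx, -⟩ := hew x mx
  obtain ⟨ey, py, cy, -⟩ := hew y my
  have hvx := hdisj v mv x mx hx.ne
  have hvy := hdisj v mv y my hy.ne
  have hxy' := hdisj x mx y my hxy
  have nvx := hvx v (w v).start_mem_support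
  have nvy := hvy v (w v).start_mem_support
  obtain ⟨p, q, r, hpqr⟩ := exists_isTriangleSplit hC ev ex ey (hne v mv x mx hx.ne)
    (hne x mx y my hxy) (hne y my v mv hy.ne')
  obtain ⟨H, hH, hCH, -, hxH, hyH⟩ := exists_isK4SubdivisionOn hpqr hv (hne v mv x mx hx.ne)
    (hne x mx y my hxy) (hne y my v mv hy.ne') (α := w v) (β := (w x).cons hx)
    (γ := (w y).cons hy) pv (px.cons nvx) (py.cons nvy) cv
    (by simp only [Walk.support_cons, List.mem_cons]; grind)
    (by simp only [Walk.support_cons, List.mem_cons]; grind)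
    (by simp only [Walk.support_cons, List.mem_cons]; grind)
    (by simp only [Walk.support_cons, List.mem_cons]; grind)
    (by simp only [Walk.support_cons, List.mem_cons]; grind)
  exact ⟨H, _, hH, hCH, hxH.2 (by simp [Walk.toSubgraph]), hyH.2 (by simp [Walk.toSubgraph]), 0, rfl⟩
end

section
/- For every 3-connected graph G on n vertices, the sum over all vertices v of G of the number of distinct cycles in the graph G−v obtained by deleting v is at least n³/8 − n²/4. -/
open SimpleGraph

variable {V : Type*}

/-- Two paths that meet only in their common endpoint concatenate to a path. -/
theorem SimpleGraph.Walk.IsPath.append_of_inter {G : SimpleGraph V} {u v w : V}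
    {p : G.Walk u v} {q : G.Walk v w} (hp : p.IsPath) (hq : q.IsPath)
    (h : ∀ z ∈ p.support, z ∈ q.support → z = v) : (p.append q).IsPath := by
  rw [Walk.isPath_def, Walk.support_append, List.nodup_append']
  refine ⟨hp.support_nodup, hq.support_nodup.tail, ?_⟩
  intro z hz hzq
  have hzv := h z hz (List.mem_of_mem_tail hzq)
  subst hzv
  have := hq.support_nodup
  rw [← Walk.cons_tail_support] at this
  exact (List.nodup_cons.1 this).1 hzq

/-- All edges of `H` lie inside `A`, and deleting at most one vertex from `H` leaves the remaining
vertices of `A` connected to each other. -/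
structure BiconnectedOn (H : SimpleGraph V) (A : Finset V) : Prop where
  mem_of_adj : ∀ ⦃u v⦄, H.Adj u v → u ∈ A
  exists_walk : ∀ ⦃W : Set V⦄, W.Subsingleton → ∀ ⦃u⦄, u ∈ A → u ∉ W → ∀ ⦃v⦄, v ∈ A → v ∉ W →
    ∃ p : H.Walk u v, ∀ z ∈ p.support, z ∉ W

/-- A path joining two distinct vertices of `A` and otherwise disjoint from `A`. -/
structure IsEar {G : SimpleGraph V} (A : Finset V) {a b : V} (q : G.Walk a b) : Prop where
  isPath : q.IsPath
  ne : a ≠ b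
  left_mem : a ∈ A
  right_mem : b ∈ A
  inter : ∀ v ∈ q.support, v ∈ A → v = a ∨ v = b

theorem BiconnectedOn.mem_of_adj_right {H : SimpleGraph V} {A : Finset V}
    (h : BiconnectedOn H A) {u v : V} (huv : H.Adj u v) : v ∈ A :=
  h.mem_of_adj huv.symm

theorem BiconnectedOn.support_subset {H : SimpleGraph V} {A : Finset V} (h : BiconnectedOn H A)
    {u v : V} (p : H.Walk u v) (hv : v ∈ A) : ∀ z ∈ p.support, z ∈ A := by
  induction p with
  | nil => simpa using hv
  | cons huv p ih =>
    intro z hz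
    rw [Walk.support_cons, List.mem_cons] at hz
    rcases hz with rfl | hz
    · exact h.mem_of_adj huv
    · exact ih hv z hz

theorem SimpleGraph.Walk.exists_isPath_first_mem {G : SimpleGraph V} {A : Finset V} {u v : V}
    (p : G.Walk u v) (hv : v ∈ A) :
    ∃ b ∈ A, ∃ q : G.Walk u b, q.IsPath ∧ (∀ z ∈ q.support, z ∈ p.support) ∧
      ∀ z ∈ q.support, z ∈ A → z = b := by
  classical
  suffices ∃ b ∈ A, ∃ q : G.Walk u b, (∀ z ∈ q.support, z ∈ p.support) ∧
      ∀ z ∈ q.support, z ∈ A → z = b by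
    obtain ⟨b, hb, q, h₁, h₂⟩ := this
    exact ⟨b, hb, q.bypass, q.bypass_isPath,
      fun z hz => h₁ z (q.support_bypass_subset_support hz),
      fun z hz => h₂ z (q.support_bypass_subset_support hz)⟩
  induction p with
  | @nil u => exact ⟨u, hv, .nil, by simp, by simp⟩
  | @cons u w v huw p ih =>
    by_cases hu : u ∈ A
    · exact ⟨u, hu, .nil, by simp, by simp⟩
    · obtain ⟨b, hb, q, h₁, h₂⟩ := ih hv
      refine ⟨b, hb, .cons huw q, ?_, ?_⟩
      · intro z hz
        rw [Walk.support_cons, List.mem_cons] at hz ⊢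
        exact hz.imp id (h₁ z)
      · intro z hz hzA
        rw [Walk.support_cons, List.mem_cons] at hz
        rcases hz with rfl | hz
        · exact absurd hzA hu
        · exact h₂ z hz hzA

theorem SimpleGraph.Walk.exists_adj_notMem_mem {G : SimpleGraph V} {A : Finset V} {u v : V}
    (p : G.Walk u v) (hu : u ∉ A) (hv : v ∈ A) : ∃ a ∈ A, ∃ z ∈ p.support, z ∉ A ∧ G.Adj a z := by
  induction p with
  | nil => exact absurd hv hu
  | @cons u w v huw p ih =>
    by_cases hw : w ∈ A
    · exact ⟨w, hw, u, by simp, hu, huw.symm⟩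
    · obtain ⟨a, ha, z, hz, h⟩ := ih hw hv
      exact ⟨a, ha, z, by simp [hz], h⟩

theorem BiconnectedOn.exists_ear {G : SimpleGraph V} {S A : Finset V} (h : BiconnectedOn G S)
    (hAS : A ⊂ S) (hA : 1 < A.card) :
    ∃ (a b : V) (q : G.Walk a b), IsEar A q ∧ (∃ z ∈ q.support, z ∉ A) ∧
      ∀ e ∈ q.edges, ∃ z ∈ e, z ∉ A := by
  obtain ⟨w, hwS, hwA⟩ := Finset.exists_of_ssubset hAS
  obtain ⟨t, ht⟩ : A.Nonempty := Finset.card_pos.1 (by omega)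
  obtain ⟨p, -⟩ := h.exists_walk Set.subsingleton_empty hwS (by simp) (hAS.1 ht) (by simp)
  obtain ⟨a, ha, z, -, hzA, haz⟩ := p.exists_adj_notMem_mem hwA ht
  obtain ⟨t', ht', hta⟩ := Finset.exists_mem_ne hA a
  obtain ⟨p', hp'⟩ := h.exists_walk (Set.subsingleton_singleton (a := a))
    (h.mem_of_adj_right haz) (by simpa using haz.ne') (hAS.1 ht') (by simpa using hta)
  obtain ⟨b, hb, q, hq, hqp, hqA⟩ := p'.exists_isPath_first_mem ht'
  have haq : a ∉ q.support := fun haq => hp' a (hqp a haq) rfl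
  refine ⟨a, b, .cons haz q, ⟨(Walk.cons_isPath_iff _ _).2 ⟨hq, haq⟩, ?_, ha, hb, ?_⟩,
    ⟨z, by simp, hzA⟩, ?_⟩
  · rintro rfl
    exact haq q.end_mem_support
  · intro v hv hvA
    rw [Walk.support_cons, List.mem_cons] at hv
    exact hv.imp id (fun hv => hqA v hv hvA)
  · intro e he
    rw [Walk.edges_cons, List.mem_cons] at he
    rcases he with rfl | he
    · exact ⟨z, by simp, hzA⟩
    · induction e with
      | h c d =>
        by_contra! hcon
        have hc := hqA c (q.fst_mem_support_of_mem_edges he) (hcon c (by simp))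
        have hd := hqA d (q.snd_mem_support_of_mem_edges he) (hcon d (by simp))
        exact (q.adj_of_mem_edges he).ne (hc.trans hd.symm)

/-- A numbering of `A` in which every vertex other than `x` and `y` has a lower and
an upper neighbour. -/
structure IsSTNumbering (H : SimpleGraph V) (x y : V) (A : Finset V) (f : V → ℝ) : Prop where
  source_mem : x ∈ A
  sink_mem : y ∈ A
  lt : f x < f y
  injOn : Set.InjOn f A
  exists_lower : ∀ v ∈ A, v ≠ x → v ≠ y → ∃ u ∈ A, H.Adj v u ∧ f u < f v
  exists_upper : ∀ v ∈ A, v ≠ x → v ≠ y → ∃ u ∈ A, H.Adj v u ∧ f v < f u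

theorem exists_between_values (A : Finset V) (f : V → ℝ) (c : V) :
    ∃ t, f c < t ∧ ∀ u ∈ A, f c < f u → t < f u := by
  by_cases hne : (A.filter (f c < f ·)).Nonempty
  · obtain ⟨m, hm, hmin⟩ := Finset.exists_min_image _ f hne
    have := (Finset.mem_filter.1 hm).2
    refine ⟨(f c + f m) / 2, by linarith, fun u hu hcu => ?_⟩
    have := hmin u (Finset.mem_filter.2 ⟨hu, hcu⟩)
    linarith
  · refine ⟨f c + 1, by linarith, fun u hu hcu => ?_⟩
    exact absurd ⟨u, Finset.mem_filter.2 ⟨hu, hcu⟩⟩ hne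

/-- Numbering the inner vertices of a path just above its first vertex `c`. -/
theorem exists_isSTNumbering_of_walk {H : SimpleGraph V} {x y c b : V} (q : H.Walk c b) :
    ∀ (A : Finset V) (f : V → ℝ), q.IsPath → (∀ v ∈ q.support, v ∈ A → v = c ∨ v = b) →
      c ∈ A → b ∈ A → x ∈ A → y ∈ A → f x < f y → f c < f b → Set.InjOn f A →
      (∀ v ∈ A, v ≠ x → v ≠ y → ∃ u ∈ A, H.Adj v u ∧ f u < f v) →
      (∀ v ∈ A, v ≠ c → v ≠ x → v ≠ y → ∃ u ∈ A, H.Adj v u ∧ f v < f u) →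
      ∃ A' f', IsSTNumbering H x y A' f' ∧ A ⊆ A' ∧ (∀ v ∈ q.support, v ∈ A') ∧
        ∀ v ∈ A', v ∈ A ∨ v ∈ q.support := by
  classical
  induction q with
  | nil =>
    intro A f _ _ _ _ _ _ _ hlt
    exact absurd hlt (lt_irrefl _)
  | @cons c z b hcz q ih =>
    intro A f hq hinter hc hb hx hy hxy hcb hinj hlow hup
    obtain ⟨hq', hcq⟩ := (Walk.cons_isPath_iff _ _).1 hq
    by_cases hzA : z ∈ A
    · have hzb : z = b := (hinter z (by simp) hzA).resolve_left hcz.ne'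
      subst hzb
      have hnil : q = .nil := Walk.eq_nil_iff_nil.2 (Walk.isPath_iff_nil.1 hq')
      subst hnil
      refine ⟨A, f, ⟨hx, hy, hxy, hinj, hlow, ?_⟩, subset_rfl, ?_, fun v hv => .inl hv⟩
      · intro v hv hvx hvy
        by_cases hvc : v = c
        · subst hvc
          exact ⟨z, hb, hcz, hcb⟩
        · exact hup v hv hvc hvx hvy
      · simp [hc, hb]
    · obtain ⟨t, hct, ht⟩ := exists_between_values A f c
      have hne : ∀ v ∈ A, v ≠ z := fun v hv h => hzA (h ▸ hv)
      have hg : ∀ v ∈ A, Function.update f z t v = f v := fun v hv =>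
        Function.update_of_ne (hne v hv) _ _
      have hgz : Function.update f z t z = t := Function.update_self _ _ _
      have htne : ∀ v ∈ A, f v ≠ t := by
        intro v hv hvt
        exact absurd (ht v hv (hvt ▸ hct)) (by simp [hvt])
      obtain ⟨A', f', hst, hsub, hsupp, hA'⟩ := ih (insert z A) (Function.update f z t) hq'
        (by
          intro v hv hvA
          rcases Finset.mem_insert.1 hvA with rfl | hvA
          · exact .inl rfl
          · rcases hinter v (by simp [hv]) hvA with rfl | rfl
            · exact absurd hv hcq
            · exact .inr rfl)
        (by simp) (by simp [hb]) (by simp [hx]) (by simp [hy])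
        (by rwa [hg x hx, hg y hy]) (by rw [hgz, hg b hb]; exact ht b hb hcb)
        (by
          intro v hv w hw hvw
          rw [Finset.mem_coe, Finset.mem_insert] at hv hw
          rcases hv with rfl | hv <;> rcases hw with rfl | hw
          · rfl
          · rw [hgz, hg w hw] at hvw
            exact absurd hvw.symm (htne w hw)
          · rw [hgz, hg v hv] at hvw
            exact absurd hvw (htne v hv)
          · rw [hg v hv, hg w hw] at hvw
            exact hinj hv hw hvw)
        (by
          intro v hv hvx hvy
          rcases Finset.mem_insert.1 hv with rfl | hv
          · exact ⟨c, by simp [hc], hcz.symm, by rwa [hgz, hg c hc]⟩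
          · obtain ⟨u, hu, hvu, huv⟩ := hlow v hv hvx hvy
            exact ⟨u, by simp [hu], hvu, by rwa [hg u hu, hg v hv]⟩)
        (by
          intro v hv hvz hvx hvy
          have hv := Finset.mem_of_mem_insert_of_ne hv hvz
          by_cases hvc : v = c
          · subst hvc
            exact ⟨z, by simp, hcz, by rwa [hgz, hg v hc]⟩
          · obtain ⟨u, hu, hvu, huv⟩ := hup v hv hvc hvx hvy
            exact ⟨u, by simp [hu], hvu, by rwa [hg u hu, hg v hv]⟩)
      refine ⟨A', f', hst, (Finset.subset_insert _ _).trans hsub, ?_, ?_⟩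
      · intro v hv
        rw [Walk.support_cons, List.mem_cons] at hv
        rcases hv with rfl | hv
        · exact hsub (by simp [hc])
        · exact hsupp v hv
      · intro v hv
        rw [Walk.support_cons, List.mem_cons]
        rcases hA' v hv with hv | hv
        · rcases Finset.mem_insert.1 hv with rfl | hv
          · exact .inr (.inr q.start_mem_support)
          · exact .inl hv
        · exact .inr (.inr hv)

theorem IsSTNumbering.exists_of_ear {H : SimpleGraph V} {x y a b : V} {A : Finset V} {f : V → ℝ}
    (hf : IsSTNumbering H x y A f) {q : H.Walk a b} (hq : IsEar A q) :
    ∃ A' f', IsSTNumbering H x y A' f' ∧ A ⊆ A' ∧ (∀ v ∈ q.support, v ∈ A') ∧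
      ∀ v ∈ A', v ∈ A ∨ v ∈ q.support := by
  rcases lt_or_gt_of_ne (fun h => hq.ne (hf.injOn hq.left_mem hq.right_mem h)) with hab | hab
  · exact exists_isSTNumbering_of_walk q A f hq.isPath hq.inter hq.left_mem hq.right_mem
      hf.source_mem hf.sink_mem hf.lt hab hf.injOn hf.exists_lower
      (fun v hv _ => hf.exists_upper v hv)
  · obtain ⟨A', f', h₁, h₂, h₃, h₄⟩ := exists_isSTNumbering_of_walk q.reverse A f
      hq.isPath.reverse (fun v hv hvA => (hq.inter v (by simpa using hv) hvA).symm)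
      hq.right_mem hq.left_mem hf.source_mem hf.sink_mem hf.lt hab hf.injOn hf.exists_lower
      (fun v hv _ => hf.exists_upper v hv)
    exact ⟨A', f', h₁, h₂, by simpa using h₃, by simpa using h₄⟩

theorem IsSTNumbering.exists_extension {H : SimpleGraph V} {x y : V} {S : Finset V}
    (hS : BiconnectedOn H S) (n : ℕ) : ∀ (A : Finset V) (f : V → ℝ), A ⊆ S → S.card ≤ A.card + n →
      IsSTNumbering H x y A f → ∃ g, IsSTNumbering H x y S g := by
  induction n with
  | zero =>
    intro A f hAS hcard hf
    exact ⟨f, Finset.eq_of_subset_of_card_le hAS hcard ▸ hf⟩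
  | succ n ih =>
    intro A f hAS hcard hf
    rcases hAS.eq_or_ssubset with rfl | hss
    · exact ⟨f, hf⟩
    · have h1 : 1 < A.card := Finset.one_lt_card.2
        ⟨x, hf.source_mem, y, hf.sink_mem, fun h => hf.lt.ne (congrArg f h)⟩
      obtain ⟨a, b, q, hq, ⟨z, hz, hzA⟩, -⟩ := hS.exists_ear hss h1
      obtain ⟨A', f', hf', hsub, hsupp, hA'⟩ := hf.exists_of_ear hq
      have hlt : A.card < A'.card := Finset.card_lt_card
        ((Finset.ssubset_iff_of_subset hsub).2 ⟨z, hsupp z hz, hzA⟩)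
      refine ih A' f' (fun v hv => ?_) (by omega) hf'
      rcases hA' v hv with hv | hv
      · exact hAS hv
      · exact hS.support_subset q (hAS hq.right_mem) v hv

theorem BiconnectedOn.exists_isSTNumbering {H : SimpleGraph V} {x y : V} {S : Finset V}
    (hS : BiconnectedOn H S) (hx : x ∈ S) (hy : y ∈ S) (hxy : x ≠ y) :
    ∃ f, IsSTNumbering H x y S f := by
  classical
  refine IsSTNumbering.exists_extension hS S.card {x, y} (fun v => if v = x then 0 else 1)
    (by simp [Finset.insert_subset_iff, hx, hy]) (by omega)
    ⟨by simp, by simp, by simp [hxy.symm], ?_, ?_, ?_⟩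
  · intro v hv w hw h
    simp only [Finset.coe_insert, Finset.coe_singleton, Set.mem_insert_iff,
      Set.mem_singleton_iff] at hv hw
    rcases hv with rfl | rfl <;> rcases hw with rfl | rfl <;> simp_all
  · intro v hv hvx hvy
    simp [hvx, hvy] at hv
  · intro v hv hvx hvy
    simp [hvx, hvy] at hv

theorem IsSTNumbering.le_sink {H : SimpleGraph V} {x y : V} {S : Finset V} {f : V → ℝ}
    (hf : IsSTNumbering H x y S f) {v : V} (hv : v ∈ S) : f v ≤ f y := by
  obtain ⟨m, hm, hmax⟩ := Finset.exists_max_image S f ⟨v, hv⟩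
  have hmy : m = y := by
    by_contra hmy
    by_cases hmx : m = x
    · subst hmx
      exact absurd (hmax y hf.sink_mem) (not_le.2 hf.lt)
    · obtain ⟨u, hu, -, hlt⟩ := hf.exists_upper m hm hmx hmy
      exact absurd (hmax u hu) (not_le.2 hlt)
  exact hmy ▸ hmax v hv

theorem IsSTNumbering.source_le {H : SimpleGraph V} {x y : V} {S : Finset V} {f : V → ℝ}
    (hf : IsSTNumbering H x y S f) {v : V} (hv : v ∈ S) : f x ≤ f v := by
  obtain ⟨m, hm, hmin⟩ := Finset.exists_min_image S f ⟨v, hv⟩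
  have hmx : m = x := by
    by_contra hmx
    by_cases hmy : m = y
    · subst hmy
      exact absurd (hmin x hf.source_mem) (not_le.2 hf.lt)
    · obtain ⟨u, hu, -, hlt⟩ := hf.exists_lower m hm hmx hmy
      exact absurd (hmin u hu) (not_le.2 hlt)
  exact hmx ▸ hmin v hv

theorem BiconnectedOn.exists_adj {H : SimpleGraph V} {S : Finset V} (hS : BiconnectedOn H S)
    {x y : V} (hx : x ∈ S) (hy : y ∈ S) (hxy : x ≠ y) : ∃ z, H.Adj x z := by
  obtain ⟨p, -⟩ := hS.exists_walk Set.subsingleton_empty hx (by simp) hy (by simp)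
  cases p with
  | nil => exact absurd rfl hxy
  | cons h _ => exact ⟨_, h⟩

theorem IsSTNumbering.exists_upper_of_ne_sink {H : SimpleGraph V} {x y : V} {S : Finset V}
    {f : V → ℝ} (hf : IsSTNumbering H x y S f) (hS : BiconnectedOn H S) {v : V} (hv : v ∈ S)
    (hvy : v ≠ y) : ∃ u, H.Adj v u ∧ f v < f u := by
  by_cases hvx : v = x
  · subst hvx
    obtain ⟨z, hz⟩ := hS.exists_adj hv hf.sink_mem hvy
    have hzS := hS.mem_of_adj_right hz
    exact ⟨z, hz, (hf.source_le hzS).lt_of_ne fun h => hz.ne (hf.injOn hv hzS h)⟩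
  · obtain ⟨u, -, h⟩ := hf.exists_upper v hv hvx hvy
    exact ⟨u, h⟩

theorem exists_isPath_along_upper [Finite V] {H : SimpleGraph V} {y : V} {S : Finset V}
    {f : V → ℝ} (hS : BiconnectedOn H S) {up : V → V}
    (hup : ∀ v ∈ S, v ≠ y → H.Adj v (up v) ∧ f v < f (up v)) (v : V) (hv : v ∈ S) :
    ∃ p : H.Walk v y, p.IsPath ∧ (∀ u ∈ p.support, f v ≤ f u) ∧
      ∀ e ∈ p.edges, ∃ u ∈ S, u ≠ y ∧ e = s(u, up u) := by
  have hwf : WellFounded (fun a b : V => f b < f a) :=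
    @Finite.wellFounded_of_trans_of_irrefl _ _ _ ⟨fun _ _ _ h₁ h₂ => h₂.trans h₁⟩
      ⟨fun _ => lt_irrefl _⟩
  induction v using hwf.induction with
  | _ v ih =>
    by_cases hvy : v = y
    · subst hvy
      exact ⟨.nil, by simp, by simp, by simp⟩
    · obtain ⟨hadj, hlt⟩ := hup v hv hvy
      obtain ⟨p, hp, hsupp, hedge⟩ := ih (up v) hlt (hS.mem_of_adj_right hadj)
      refine ⟨.cons hadj p, (Walk.cons_isPath_iff _ _).2 ⟨hp, ?_⟩, ?_, ?_⟩
      · exact fun hvp => absurd (hsupp v hvp) (not_le.2 hlt)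
      · intro u hu
        rw [Walk.support_cons, List.mem_cons] at hu
        rcases hu with rfl | hu
        · exact le_rfl
        · exact hlt.le.trans (hsupp u hu)
      · intro e he
        rw [Walk.edges_cons, List.mem_cons] at he
        rcases he with rfl | he
        · exact ⟨v, hv, hvy, rfl⟩
        · exact hedge e he

/-- The number of the lower end of an edge. -/
def lowerEnd (f : V → ℝ) : Sym2 V → ℝ :=
  Sym2.lift ⟨fun a b => min (f a) (f b), fun _ _ => min_comm _ _⟩

theorem lowerEnd_mk_of_lt {f : V → ℝ} {a b : V} (h : f a < f b) : lowerEnd f s(a, b) = f a :=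
  min_eq_left h.le

theorem IsSTNumbering.exists_isPath_from_source [Finite V] {H : SimpleGraph V} {x y : V}
    {S : Finset V} {f : V → ℝ} (hf : IsSTNumbering H x y S f) (v : V) (hv : v ∈ S) (hvy : v ≠ y) :
    ∃ p : H.Walk x v, p.IsPath ∧ (∀ u ∈ p.support, f u ≤ f v) ∧
      ∀ e ∈ p.edges, lowerEnd f e < f v := by
  have hwf : WellFounded (fun a b : V => f a < f b) :=
    @Finite.wellFounded_of_trans_of_irrefl _ _ _ ⟨fun _ _ _ h₁ h₂ => h₁.trans h₂⟩
      ⟨fun _ => lt_irrefl _⟩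
  induction v using hwf.induction with
  | _ v ih =>
    by_cases hvx : v = x
    · subst hvx
      exact ⟨.nil, by simp, by simp, by simp⟩
    · obtain ⟨u, hu, hadj, hlt⟩ := hf.exists_lower v hv hvx hvy
      have huy : u ≠ y := by
        rintro rfl
        exact absurd (hf.le_sink hv) (not_le.2 hlt)
      obtain ⟨p, hp, hsupp, hedge⟩ := ih u hlt hu huy
      refine ⟨p.concat hadj.symm, hp.concat (fun hvp => absurd (hsupp v hvp) (not_le.2 hlt)) _,
        ?_, ?_⟩
      · intro w hw
        rw [Walk.support_concat, List.mem_append, List.mem_singleton] at hw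
        rcases hw with hw | rfl
        · exact (hsupp w hw).trans hlt.le
        · exact le_rfl
      · intro e he
        rw [Walk.edges_concat, List.concat_eq_append, List.mem_append, List.mem_singleton] at he
        rcases he with he | rfl
        · exact (hedge e he).trans hlt
        · rwa [lowerEnd_mk_of_lt hlt]

open scoped Classical in
/-- A graph that is biconnected on `S`, with `m` edges, has at least `m - |S| + 2` paths between
any two vertices of `S`, even when paths are identified with their edge sets. -/
theorem BiconnectedOn.exists_paths [Finite V] {H : SimpleGraph V} {x y : V} {S : Finset V}
    (hS : BiconnectedOn H S) (hx : x ∈ S) (hy : y ∈ S) (hxy : x ≠ y) :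
    ∃ P : Finset (Finset (Sym2 V)),
      (∀ E ∈ P, ∃ p : H.Walk x y, p.IsPath ∧ p.edges.toFinset = E) ∧
      H.edgeSet.ncard + 2 ≤ S.card + P.card := by
  obtain ⟨f, hf⟩ := hS.exists_isSTNumbering hx hy hxy
  have hex : ∀ v, ∃ u, v ∈ S → v ≠ y → H.Adj v u ∧ f v < f u := by
    intro v
    by_cases h : v ∈ S ∧ v ≠ y
    · obtain ⟨u, hu⟩ := hf.exists_upper_of_ne_sink hS h.1 h.2
      exact ⟨u, fun _ _ => hu⟩
    · exact ⟨v, fun h₁ h₂ => absurd ⟨h₁, h₂⟩ h⟩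
  choose up hup using hex
  obtain ⟨p₀, hp₀, -, he₀⟩ := exists_isPath_along_upper hS hup x hx
  set F : Finset (Sym2 V) := (S.erase y).image fun v => s(v, up v) with hF
  have hFcard : F.card ≤ S.card - 1 := by
    rw [← Finset.card_erase_of_mem hy]
    exact Finset.card_image_le
  have hFmem : ∀ e, (∃ u ∈ S, u ≠ y ∧ e = s(u, up u)) → e ∈ F := by
    rintro e ⟨u, hu, huy, rfl⟩
    exact Finset.mem_image.2 ⟨u, Finset.mem_erase.2 ⟨huy, hu⟩, rfl⟩
  have hfin : H.edgeSet.Finite := Set.toFinite _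
  set B : Finset (Sym2 V) := hfin.toFinset \ F with hB
  have hBcard : H.edgeSet.ncard ≤ B.card + F.card := by
    rw [Set.ncard_eq_toFinset_card _ hfin]
    exact Finset.card_le_card_sdiff_add_card
  have horient : ∀ e ∈ H.edgeSet, ∃ v w, H.Adj v w ∧ f v < f w ∧ e = s(v, w) := by
    intro e he
    induction e with
    | h c d =>
      have hcd : H.Adj c d := he
      rcases lt_or_gt_of_ne (fun h => hcd.ne
        (hf.injOn (hS.mem_of_adj hcd) (hS.mem_of_adj_right hcd) h)) with h | h
      · exact ⟨c, d, hcd, h, rfl⟩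
      · exact ⟨d, c, hcd.symm, h, Sym2.eq_swap⟩
  have hpath : ∀ e : Sym2 V, ∃ E : Finset (Sym2 V), e ∈ B →
      (∃ p : H.Walk x y, p.IsPath ∧ p.edges.toFinset = E) ∧ e ∈ E ∧
        ∀ e' ∈ E, e' ∈ B → e' = e ∨ lowerEnd f e' < lowerEnd f e := by
    intro e
    by_cases he : e ∈ B
    swap
    · exact ⟨∅, fun h => absurd h he⟩
    obtain ⟨v, w, hvw, hlt, rfl⟩ := horient e (by simpa using (Finset.mem_sdiff.1 he).1)
    have hv := hS.mem_of_adj hvw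
    have hw := hS.mem_of_adj_right hvw
    have hvy : v ≠ y := by
      rintro rfl
      exact absurd (hf.le_sink hw) (not_le.2 hlt)
    obtain ⟨p, hp, hps, hpe⟩ := hf.exists_isPath_from_source v hv hvy
    obtain ⟨q, hq, hqs, hqe⟩ := exists_isPath_along_upper hS hup w hw
    refine ⟨(p.append (.cons hvw q)).edges.toFinset, fun _ => ⟨⟨_, hp.append_of_inter
      ((Walk.cons_isPath_iff _ _).2 ⟨hq, fun h => absurd (hqs v h) (not_le.2 hlt)⟩) ?_, rfl⟩,
      by simp, ?_⟩⟩
    · intro z hz hz'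
      rw [Walk.support_cons, List.mem_cons] at hz'
      rcases hz' with rfl | hz'
      · rfl
      · linarith [hps z hz, hqs z hz']
    · intro e' he' he'B
      rw [List.mem_toFinset, Walk.edges_append, List.mem_append, Walk.edges_cons,
        List.mem_cons] at he'
      rcases he' with he' | he' | he'
      · right
        rw [lowerEnd_mk_of_lt hlt]
        exact hpe e' he'
      · exact .inl he'
      · exact absurd (hFmem e' (hqe e' he')) (Finset.mem_sdiff.1 he'B).2
  choose φ hφ using hpath
  refine ⟨insert p₀.edges.toFinset (B.image φ), ?_, ?_⟩
  · intro E hE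
    rcases Finset.mem_insert.1 hE with rfl | hE
    · exact ⟨p₀, hp₀, rfl⟩
    · obtain ⟨e, he, rfl⟩ := Finset.mem_image.1 hE
      exact (hφ e he).1
  · have hinj : Set.InjOn φ B := by
      intro e he e' he' h
      have h₁ := (hφ e' he').2.2 e (h ▸ (hφ e he).2.1) he
      have h₂ := (hφ e he).2.2 e' (h ▸ (hφ e' he').2.1) he'
      rcases h₁ with h₁ | h₁
      · exact h₁
      · rcases h₂ with h₂ | h₂
        · exact h₂.symm
        · exact absurd h₁ h₂.asymm
    rw [Finset.card_insert_of_notMem, Finset.card_image_of_injOn hinj]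
    · have : 0 < S.card := Finset.card_pos.2 ⟨y, hy⟩
      omega
    · intro hmem
      obtain ⟨e, he, hEq⟩ := Finset.mem_image.1 hmem
      have h₁ := (hφ e he).2.1
      rw [hEq, List.mem_toFinset] at h₁
      exact (Finset.mem_sdiff.1 he).2 (hFmem e (he₀ e h₁))

open scoped Classical in
/-- `E` is the edge set of a cycle of `H`. -/
def IsCycleEdgeSet (H : SimpleGraph V) (E : Finset (Sym2 V)) : Prop :=
  ∃ (u : V) (c : H.Walk u u), c.IsCycle ∧ c.edges.toFinset = E

theorem IsCycleEdgeSet.mono {H H' : SimpleGraph V} (h : H ≤ H') {E : Finset (Sym2 V)}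
    (hE : IsCycleEdgeSet H E) : IsCycleEdgeSet H' E := by
  obtain ⟨u, c, hc, rfl⟩ := hE
  exact ⟨u, c.mapLe h, hc.mapLe h, by rw [Walk.edges_mapLe_eq_edges]⟩

/-- The graph obtained from `H` by adding the edges of a walk. -/
def supWalk {G : SimpleGraph V} (H : SimpleGraph V) {a b : V} (q : G.Walk a b) : SimpleGraph V :=
  H ⊔ fromEdgeSet {e | e ∈ q.edges}

theorem edgeSet_supWalk {G H : SimpleGraph V} {a b : V} (q : G.Walk a b) :
    (supWalk H q).edgeSet = H.edgeSet ∪ {e | e ∈ q.edges} := by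
  rw [supWalk, edgeSet_sup, edgeSet_fromEdgeSet]
  congr 1
  ext e
  simp only [Set.mem_sdiff, Set.mem_ofPred_eq, and_iff_left_iff_imp]
  intro he
  exact G.not_isDiag_of_mem_edgeSet (q.edges_subset_edgeSet he)

theorem supWalk_le {G H : SimpleGraph V} (hHG : H ≤ G) {a b : V} (q : G.Walk a b) :
    supWalk H q ≤ G := by
  rw [← edgeSet_subset_edgeSet, edgeSet_supWalk]
  exact Set.union_subset (edgeSet_mono hHG) fun e he => q.edges_subset_edgeSet he

theorem le_supWalk {G : SimpleGraph V} (H : SimpleGraph V) {a b : V} (q : G.Walk a b) :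
    H ≤ supWalk H q := le_sup_left

open scoped Classical in
theorem BiconnectedOn.union_ear {G H : SimpleGraph V} {A : Finset V} (hA : BiconnectedOn H A)
    {a b : V} {q : G.Walk a b} (hq : IsEar A q) :
    BiconnectedOn (supWalk H q) (A ∪ q.support.toFinset) := by
  have hqe : ∀ e ∈ q.edges, e ∈ (supWalk H q).edgeSet := fun e he => by
    rw [edgeSet_supWalk]
    exact .inr he
  have key : ∀ ⦃W : Set V⦄, W.Subsingleton → ∀ ⦃u⦄, u ∈ A ∪ q.support.toFinset → u ∉ W →
      ∃ t ∈ A, t ∉ W ∧ ∃ p : (supWalk H q).Walk u t, ∀ z ∈ p.support, z ∉ W := by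
    intro W hW u hu huW
    rcases Finset.mem_union.1 hu with hu | hu
    · exact ⟨u, hu, huW, .nil, by simpa using huW⟩
    · rw [List.mem_toFinset] at hu
      obtain ⟨q₁, q₂, -, -, rfl⟩ := hq.isPath.mem_support_iff_exists_append.1 hu
      by_cases h₁ : ∀ z ∈ q₁.support, z ∉ W
      · exact ⟨a, hq.left_mem, h₁ a q₁.start_mem_support,
          (q₁.transfer _ fun e he => hqe e (by simp [he])).reverse, by simpa using h₁⟩
      · push Not at h₁
        obtain ⟨w, hw, hwW⟩ := h₁
        have h₂ : ∀ z ∈ q₂.support, z ∉ W := by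
          intro z hz hzW
          have hzu : z ≠ u := fun h => huW (h ▸ hzW)
          exact hq.isPath.ne_of_mem_support_of_append hzu hw hz (hW hwW hzW)
        exact ⟨b, hq.right_mem, h₂ b q₂.end_mem_support,
          q₂.transfer _ fun e he => hqe e (by simp [he]), by simpa using h₂⟩
  refine ⟨?_, ?_⟩
  · intro u v huv
    have : s(u, v) ∈ (supWalk H q).edgeSet := huv
    rw [edgeSet_supWalk] at this
    rw [Finset.mem_union, List.mem_toFinset]
    rcases this with h | h
    · exact .inl (hA.mem_of_adj h)
    · exact .inr (q.fst_mem_support_of_mem_edges h)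
  · intro W hW u hu huW v hv hvW
    obtain ⟨t, ht, htW, p, hp⟩ := key hW hu huW
    obtain ⟨t', ht', htW', p', hp'⟩ := key hW hv hvW
    obtain ⟨r, hr⟩ := hA.exists_walk hW ht htW ht' htW'
    refine ⟨p.append ((r.mapLe (le_supWalk H q)).append p'.reverse), ?_⟩
    intro z hz
    simp only [Walk.mem_support_append_iff, Walk.support_mapLe_eq_support, Walk.support_reverse,
      List.mem_reverse] at hz
    rcases hz with hz | hz | hz
    · exact hp z hz
    · exact hr z hz
    · exact hp' z hz

open scoped Classical in
theorem IsEar.card_union {G : SimpleGraph V} {A : Finset V} {a b : V} {q : G.Walk a b}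
    (hq : IsEar A q) : (A ∪ q.support.toFinset).card + 1 = A.card + q.length := by
  have h := Finset.card_union_add_card_inter A q.support.toFinset
  have hinter : A ∩ q.support.toFinset = {a, b} := by
    ext v
    simp only [Finset.mem_inter, List.mem_toFinset, Finset.mem_insert, Finset.mem_singleton]
    constructor
    · rintro ⟨hv, hvq⟩
      exact hq.inter v hvq hv
    · rintro (rfl | rfl)
      · exact ⟨hq.left_mem, q.start_mem_support⟩
      · exact ⟨hq.right_mem, q.end_mem_support⟩
  rw [hinter, Finset.card_pair hq.ne, List.toFinset_card_of_nodup hq.isPath.support_nodup,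
    Walk.length_support] at h
  omega

theorem ncard_edgeSet_supWalk [Finite V] {G H : SimpleGraph V} {a b : V} {q : G.Walk a b}
    (hq : q.IsPath) (hqH : ∀ e ∈ q.edges, e ∉ H.edgeSet) :
    (supWalk H q).edgeSet.ncard = H.edgeSet.ncard + q.length := by
  classical
  have hcoe : {e | e ∈ q.edges} = (q.edges.toFinset : Set (Sym2 V)) := by simp
  rw [edgeSet_supWalk, hcoe,
    Set.ncard_union_eq (Set.disjoint_left.2 fun e he he' => hqH e (by simpa using he') he)
    (Set.toFinite _) (Set.toFinite _)]
  congr 1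
  rw [Set.ncard_coe_finset,
    List.toFinset_card_of_nodup hq.isTrail.edges_nodup, Walk.length_edges]

open scoped Classical in
theorem isCycleEdgeSet_union {H : SimpleGraph V} {a b : V} {p q : H.Walk a b} (hp : p.IsPath)
    (hq : q.IsPath) (hab : a ≠ b) (hpq : ∀ v ∈ q.support, v ∈ p.support → v = a ∨ v = b)
    (hedge : ∀ e ∈ q.edges, e ∉ p.edges) :
    IsCycleEdgeSet H (p.edges.toFinset ∪ q.edges.toFinset) := by
  cases q with
  | nil => exact absurd rfl hab
  | @cons _ z _ h r =>
    obtain ⟨hr, har⟩ := (Walk.cons_isPath_iff _ _).1 hq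
    refine ⟨a, .cons h (r.append p.reverse), (Walk.cons_isCycle_iff _ _).2
      ⟨hr.append_of_inter hp.reverse ?_, ?_⟩, ?_⟩
    · intro v hv hv'
      rw [Walk.support_reverse, List.mem_reverse] at hv'
      refine (hpq v (by simp [hv]) hv').resolve_left ?_
      rintro rfl
      exact har hv
    · rw [Walk.edges_append, List.mem_append, Walk.edges_reverse, List.mem_reverse]
      rintro (he | he)
      · exact har (r.fst_mem_support_of_mem_edges he)
      · exact hedge s(a, z) (by simp) he
    · ext e
      simp only [Walk.edges_cons, Walk.edges_append, Walk.edges_reverse, List.mem_toFinset,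
        List.mem_cons, List.mem_append, List.mem_reverse, Finset.mem_union]
      tauto

open scoped Classical in
theorem IsEar.isCycleEdgeSet {G H : SimpleGraph V} {A : Finset V} (hA : BiconnectedOn H A)
    {a b : V} {q : G.Walk a b} (hq : IsEar A q) (hqH : ∀ e ∈ q.edges, e ∉ H.edgeSet)
    {p : H.Walk a b} (hp : p.IsPath) :
    IsCycleEdgeSet (supWalk H q) (p.edges.toFinset ∪ q.edges.toFinset) := by
  have hqe : ∀ e ∈ q.edges, e ∈ (supWalk H q).edgeSet := fun e he => by
    rw [edgeSet_supWalk]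
    exact .inr he
  have h := isCycleEdgeSet_union (hp.mapLe (le_supWalk H q)) (hq.isPath.transfer hqe) hq.ne
    (fun v hv hv' => hq.inter v (by simpa using hv)
      (hA.support_subset p hq.right_mem v (by simpa using hv')))
    (fun e he he' => hqH e (by simpa using he) (p.edges_subset_edgeSet (by simpa using he')))
  rwa [Walk.edges_mapLe_eq_edges, Walk.edges_transfer] at h

/-- Adding an ear to a biconnected graph of cycle rank `r` creates at least `r + 1` cycles. -/
theorem IsEar.exists_cycles [Finite V] {G H : SimpleGraph V} {A : Finset V}
    (hA : BiconnectedOn H A) {a b : V} {q : G.Walk a b} (hq : IsEar A q)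
    (hqH : ∀ e ∈ q.edges, e ∉ H.edgeSet) {C : Finset (Finset (Sym2 V))}
    (hC : ∀ E ∈ C, IsCycleEdgeSet H E) :
    ∃ C' : Finset (Finset (Sym2 V)), (∀ E ∈ C', IsCycleEdgeSet (supWalk H q) E) ∧
      C.card + H.edgeSet.ncard + 2 ≤ C'.card + A.card := by
  classical
  obtain ⟨P, hP, hcard⟩ := hA.exists_paths hq.left_mem hq.right_mem hq.ne
  have hPH : ∀ E ∈ P, ∀ e ∈ E, e ∉ q.edges := by
    intro E hE e he heq
    obtain ⟨p, -, rfl⟩ := hP E hE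
    exact hqH e heq (p.edges_subset_edgeSet (by simpa using he))
  obtain ⟨e₀, he₀⟩ : ∃ e, e ∈ q.edges := by
    refine List.exists_mem_of_ne_nil _ fun h => hq.ne ?_
    rw [Walk.edges_eq_nil] at h
    exact h.eq
  have hinj : Set.InjOn (· ∪ q.edges.toFinset) (P : Set (Finset (Sym2 V))) := by
    intro E hE E' hE' h
    have h : E ∪ q.edges.toFinset = E' ∪ q.edges.toFinset := h
    have hd : ∀ E ∈ P, (E ∪ q.edges.toFinset) \ q.edges.toFinset = E := fun E hE =>
      Finset.union_sdiff_cancel_right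
        (Finset.disjoint_left.2 fun e he he' => hPH E hE e he (by simpa using he'))
    rw [← hd E hE, h, hd E' hE']
  have hdisj : Disjoint C (P.image (· ∪ q.edges.toFinset)) := by
    rw [Finset.disjoint_left]
    intro E hE hE'
    obtain ⟨u, c, -, rfl⟩ := hC E hE
    obtain ⟨F, -, hF⟩ := Finset.mem_image.1 hE'
    have he : e₀ ∈ c.edges := by
      rw [← List.mem_toFinset (l := c.edges), ← hF]
      simp [he₀]
    exact hqH e₀ he₀ (c.edges_subset_edgeSet he)
  refine ⟨C ∪ P.image (· ∪ q.edges.toFinset), ?_, ?_⟩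
  · intro E hE
    rcases Finset.mem_union.1 hE with hE | hE
    · exact (hC E hE).mono (le_supWalk H q)
    · obtain ⟨F, hF, rfl⟩ := Finset.mem_image.1 hE
      obtain ⟨p, hp, rfl⟩ := hP F hF
      exact hq.isCycleEdgeSet hA hqH hp
  · rw [Finset.card_union_of_disjoint hdisj, Finset.card_image_of_injOn hinj]
    omega

theorem BiconnectedOn.exists_ear_of_subgraph [Fintype V] {G H : SimpleGraph V} {A : Finset V}
    (hG : BiconnectedOn G Finset.univ) (hHG : H ≤ G) (hA : BiconnectedOn H A) (hcard : 1 < A.card)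
    (hne : ¬(H = G ∧ A = Finset.univ)) :
    ∃ (a b : V) (q : G.Walk a b), IsEar A q ∧ ∀ e ∈ q.edges, e ∉ H.edgeSet := by
  by_cases hAu : A = Finset.univ
  · have hlt : ¬ G ≤ H := fun h => hne ⟨le_antisymm hHG h, hAu⟩
    rw [← edgeSet_subset_edgeSet, Set.not_subset] at hlt
    obtain ⟨e, he, heH⟩ := hlt
    induction e with
    | h a b =>
      have hab : G.Adj a b := he
      refine ⟨a, b, hab.toWalk, ⟨Walk.IsPath.of_adj hab, hab.ne, by simp [hAu], by simp [hAu], ?_⟩,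
        ?_⟩
      · intro v hv _
        simpa using hv
      · intro e he
        have : e = s(a, b) := by simpa using he
        exact this ▸ heH
  · obtain ⟨a, b, q, hq, -, hqe⟩ :=
      hG.exists_ear (Finset.ssubset_univ_iff.2 hAu) hcard
    refine ⟨a, b, q, hq, fun e he heH => ?_⟩
    obtain ⟨z, hz, hzA⟩ := hqe e he
    obtain ⟨w, rfl⟩ := Sym2.mem_iff_exists.1 hz
    exact hzA (hA.mem_of_adj heH)

theorem BiconnectedOn.exists_cycles_of_subgraph [Fintype V] {G : SimpleGraph V}
    (hG : BiconnectedOn G Finset.univ) (n : ℕ) : ∀ (H : SimpleGraph V) (A : Finset V) (r : ℕ)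
      (C : Finset (Finset (Sym2 V))), H ≤ G → BiconnectedOn H A → 1 < A.card →
      H.edgeSet.ncard + 1 = A.card + r → (∀ E ∈ C, IsCycleEdgeSet H E) →
      r * (r + 1) ≤ 2 * C.card → G.edgeSet.ncard ≤ H.edgeSet.ncard + n →
      ∃ (r : ℕ) (C : Finset (Finset (Sym2 V))), (∀ E ∈ C, IsCycleEdgeSet G E) ∧
        G.edgeSet.ncard + 1 = Fintype.card V + r ∧ r * (r + 1) ≤ 2 * C.card := by
  classical
  induction n with
  | zero =>
    intro H A r C hHG hA hcard hr hC hrC hle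
    by_cases hne : H = G ∧ A = Finset.univ
    · obtain ⟨rfl, rfl⟩ := hne
      exact ⟨r, C, hC, hr, hrC⟩
    · exfalso
      obtain ⟨a, b, q, hq, hqH⟩ := hG.exists_ear_of_subgraph hHG hA hcard hne
      have h₁ := ncard_edgeSet_supWalk hq.isPath hqH
      have h₂ := Set.ncard_le_ncard (edgeSet_mono (supWalk_le hHG q)) (Set.toFinite _)
      exact hq.ne (Walk.eq_of_length_eq_zero (p := q) (by omega))
  | succ n ih =>
    intro H A r C hHG hA hcard hr hC hrC hle
    by_cases hne : H = G ∧ A = Finset.univ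
    · obtain ⟨rfl, rfl⟩ := hne
      exact ⟨r, C, hC, hr, hrC⟩
    · obtain ⟨a, b, q, hq, hqH⟩ := hG.exists_ear_of_subgraph hHG hA hcard hne
      have h₁ := ncard_edgeSet_supWalk hq.isPath hqH
      have hlen : q.length ≠ 0 := fun h => hq.ne (Walk.eq_of_length_eq_zero h)
      obtain ⟨C', hC', hcC'⟩ := hq.exists_cycles hA hqH hC
      have hu := hq.card_union
      refine ih (supWalk H q) (A ∪ q.support.toFinset) (r + 1) C' (supWalk_le hHG q)
        (hA.union_ear hq) (hcard.trans_le (Finset.card_le_card Finset.subset_union_left))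
        (by omega) hC' ?_ (by omega)
      have : C.card + (r + 1) ≤ C'.card := by omega
      nlinarith

/-- A biconnected graph of cycle rank `r` has at least `r (r + 1) / 2` cycles. -/
theorem BiconnectedOn.exists_cycles [Fintype V] {G : SimpleGraph V}
    (hG : BiconnectedOn G Finset.univ) (hV : 1 < Fintype.card V) :
    ∃ (r : ℕ) (C : Finset (Finset (Sym2 V))), (∀ E ∈ C, IsCycleEdgeSet G E) ∧
      G.edgeSet.ncard + 1 = Fintype.card V + r ∧ r * (r + 1) ≤ 2 * C.card := by
  classical
  obtain ⟨x, y, hxy⟩ := Fintype.one_lt_card_iff.1 hV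
  obtain ⟨z, hxz⟩ := hG.exists_adj (Finset.mem_univ x) (Finset.mem_univ y) hxy
  have hadj : (edge x z).Adj x z := by simp [edge_adj, hxz.ne]
  refine hG.exists_cycles_of_subgraph G.edgeSet.ncard (edge x z) {x, z} 0 ∅
    (by simpa [edge_le_iff] using .inr hxz) ⟨?_, ?_⟩ (by simp [hxz.ne]) ?_ (by simp) (by simp)
    (by omega)
  · intro u v huv
    rw [edge_adj] at huv
    rw [Finset.mem_insert, Finset.mem_singleton]
    tauto
  · intro W hW u hu huW v hv hvW
    rw [Finset.mem_insert, Finset.mem_singleton] at hu hv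
    rcases hu with rfl | rfl <;> rcases hv with rfl | rfl
    · exact ⟨.nil, by simpa using huW⟩
    · exact ⟨hadj.toWalk, by simp [huW, hvW]⟩
    · exact ⟨hadj.symm.toWalk, by simp [huW, hvW]⟩
    · exact ⟨.nil, by simpa using huW⟩
  · rw [edgeSet_edge_of_ne hxz.ne, Set.ncard_singleton, Finset.card_pair hxz.ne]

theorem card_le_ncard_isCycleSubgraph [Finite V] {G : SimpleGraph V}
    {C : Finset (Finset (Sym2 V))} (hC : ∀ E ∈ C, IsCycleEdgeSet G E) :
    C.card ≤ {H : G.Subgraph | IsCycleSubgraph H}.ncard := by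
  classical
  have hsub : (fun E : Finset (Sym2 V) => (E : Set (Sym2 V))) '' C ⊆
      Subgraph.edgeSet '' {H : G.Subgraph | IsCycleSubgraph H} := by
    rintro _ ⟨E, hE, rfl⟩
    obtain ⟨u, c, hc, rfl⟩ := hC E hE
    refine ⟨c.toSubgraph, ⟨u, c, hc, rfl⟩, ?_⟩
    ext e
    simp
  calc C.card = (C : Set (Finset (Sym2 V))).ncard := (Set.ncard_coe_finset C).symm
    _ = ((fun E : Finset (Sym2 V) => (E : Set (Sym2 V))) '' C).ncard :=
      (Set.ncard_image_of_injective _ Finset.coe_injective).symm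
    _ ≤ (Subgraph.edgeSet '' {H : G.Subgraph | IsCycleSubgraph H}).ncard :=
      Set.ncard_le_ncard hsub (Set.toFinite _)
    _ ≤ _ := Set.ncard_image_le (Set.toFinite _)

theorem IsKConnected.biconnectedOn_induce [Fintype V] {G : SimpleGraph V} (hG : IsKConnected 3 G)
    (v : V) [Fintype {u | u ≠ v}] :
    BiconnectedOn (G.induce {u | u ≠ v}) Finset.univ := by
  classical
  refine ⟨fun _ _ _ => Finset.mem_univ _, fun W hW a _ haW b _ hbW => ?_⟩
  obtain ⟨T, hT⟩ : ∃ T : Finset {u | u ≠ v}, (T : Set {u | u ≠ v}) = W :=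
    ⟨(Set.toFinite W).toFinset, by simp⟩
  subst hT
  have hTcard : T.card ≤ 1 := Finset.card_le_one.2 fun x hx y hy => hW hx hy
  set S : Finset V := insert v (T.image Subtype.val) with hS
  have hScard : S.card < 3 := by
    have h₁ := Finset.card_insert_le v (T.image Subtype.val)
    have h₂ : (T.image Subtype.val).card ≤ T.card := Finset.card_image_le
    rw [hS]
    omega
  have hmem : ∀ x : {u | u ≠ v}, x ∉ (T : Set {u | u ≠ v}) → (x : V) ∈ ((S : Set V)ᶜ) := by
    intro x hx
    rw [Set.mem_compl_iff, Finset.mem_coe, hS, Finset.mem_insert, Finset.mem_image]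
    rintro (h | ⟨y, hy, hyx⟩)
    · exact x.2 h
    · exact hx (Subtype.ext hyx ▸ hy)
  have hle : ((S : Set V)ᶜ) ⊆ {u | u ≠ v} := by
    rintro x hx rfl
    exact hx (by simp [hS])
  obtain ⟨p⟩ := (hG.2 S hScard).preconnected ⟨a, hmem a haW⟩ ⟨b, hmem b hbW⟩
  refine ⟨p.map (G.induceHomOfLE hle).toHom, fun z hz hzT => ?_⟩
  have hz' : z ∈ p.support.map (G.induceHomOfLE hle).toHom := by
    rw [← Walk.support_map]
    exact hz
  obtain ⟨y, -, rfl⟩ := List.mem_map.1 hz'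
  exact y.2 (by simpa [hS] using .inr ⟨hle y.2, hzT⟩)

theorem IsKConnected.le_degree [Fintype V] {G : SimpleGraph V} [DecidableRel G.Adj] {k : ℕ}
    (hG : IsKConnected k G) (v : V) : k ≤ G.degree v := by
  classical
  by_contra! hlt
  have hv : v ∈ ((G.neighborFinset v : Set V)ᶜ) := by simp
  have hcard : (insert v (G.neighborFinset v)).card < Fintype.card V := by
    have := Finset.card_insert_le v (G.neighborFinset v)
    rw [card_neighborFinset_eq_degree] at this
    have := hG.1
    omega
  obtain ⟨w, hw⟩ : ∃ w, w ∉ insert v (G.neighborFinset v) := by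
    by_contra! h
    rw [Finset.eq_univ_iff_forall.2 h, Finset.card_univ] at hcard
    exact lt_irrefl _ hcard
  rw [Finset.mem_insert, not_or] at hw
  obtain ⟨p⟩ := (hG.2 (G.neighborFinset v) (by simpa using hlt)).preconnected
    ⟨v, hv⟩ ⟨w, by simpa using hw.2⟩
  cases p with
  | nil => exact hw.1 rfl
  | cons h _ =>
    rename_i z _
    exact z.2 (by simpa using h)

theorem ncard_edgeSet_induce_ne_add_degree [Fintype V] (G : SimpleGraph V) [DecidableRel G.Adj]
    (v : V) : (G.induce {u | u ≠ v}).edgeSet.ncard + G.degree v = G.edgeFinset.card := by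
  classical
  have h := G.card_edgeFinset_induce_compl_singleton v
  rw [card_edgeFinset_deleteIncidenceSet] at h
  have hle : G.degree v ≤ G.edgeFinset.card := by
    rw [← card_incidenceFinset_eq_degree]
    exact Finset.card_le_card (G.incidenceFinset_subset v)
  have hcard : (G.induce {u | u ≠ v}).edgeSet.ncard = (G.induce {v}ᶜ).edgeFinset.card := by
    rw [← Set.ncard_coe_finset, coe_edgeFinset]
    rfl
  omega

/-- The number of cycles of `G - v` in terms of the cycle rank `|E(G)| - deg v - |V(G)| + 2`. -/
theorem IsKConnected.mul_le_two_mul_ncard [Fintype V] {G : SimpleGraph V} [DecidableRel G.Adj]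
    (hG : IsKConnected 3 G) (v : V) :
    ((G.edgeFinset.card : ℝ) - G.degree v - Fintype.card V + 2) *
        ((G.edgeFinset.card : ℝ) - G.degree v - Fintype.card V + 3) ≤
      2 * ({H : (G.induce {u | u ≠ v}).Subgraph | IsCycleSubgraph H}.ncard : ℝ) := by
  classical
  have hcard : Fintype.card {u | u ≠ v} = Fintype.card V - 1 := Set.card_ne_eq v
  have hV := hG.1
  obtain ⟨r, C, hC, hr, hrC⟩ := (hG.biconnectedOn_induce v).exists_cycles (by omega)
  have hedge := ncard_edgeSet_induce_ne_add_degree G v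
  have hsum : G.edgeFinset.card + 2 = G.degree v + Fintype.card V + r := by omega
  have hsumR : (G.edgeFinset.card : ℝ) + 2 = G.degree v + Fintype.card V + r := by
    exact_mod_cast hsum
  have hle : r * (r + 1) ≤ 2 * {H : (G.induce {u | u ≠ v}).Subgraph | IsCycleSubgraph H}.ncard :=
    hrC.trans (Nat.mul_le_mul_left 2 (card_le_ncard_isCycleSubgraph hC))
  have hleR : (r : ℝ) * (r + 1) ≤
      2 * ({H : (G.induce {u | u ≠ v}).Subgraph | IsCycleSubgraph H}.ncard : ℝ) := by
    exact_mod_cast hle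
  have h₁ : (G.edgeFinset.card : ℝ) - G.degree v - Fintype.card V + 2 = r := by linarith
  have h₂ : (G.edgeFinset.card : ℝ) - G.degree v - Fintype.card V + 3 = r + 1 := by linarith
  rwa [h₁, h₂]

/-- For every 3-connected graph `G` on `n` vertices, the sum over all
vertices `v` of the number of distinct cycles of `G - v` is at least `n³/8 - n²/4`. -/
theorem stmt8 [Fintype V] {G : SimpleGraph V} (hG : IsKConnected 3 G) :
    (Fintype.card V : ℝ) ^ 3 / 8 - (Fintype.card V : ℝ) ^ 2 / 4 ≤
      ∑ v : V,
        ({H : (G.induce {u | u ≠ v}).Subgraph | IsCycleSubgraph H}.ncard : ℝ) := by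
  classical
  set n : ℝ := (Fintype.card V : ℝ) with hn
  set m : ℝ := (G.edgeFinset.card : ℝ) with hm
  have hn3 : 3 ≤ n := by
    rw [hn]
    exact_mod_cast hG.1.le
  have hdeg : ∑ v : V, (G.degree v : ℝ) = 2 * m := by
    rw [hm]
    exact_mod_cast G.sum_degrees_eq_twice_card_edges
  have hmn : 3 * n ≤ 2 * m := by
    rw [← hdeg, hn, mul_comm, ← nsmul_eq_mul, ← Finset.card_univ]
    exact Finset.card_nsmul_le_sum _ _ _ fun v _ => by exact_mod_cast hG.le_degree v
  -- the tangent of `r ↦ r (r + 1) / 2` at `(n - 2) / 2`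
  have htangent : ∀ v : V,
      (n - 2) * n / 8 + (n - 1) / 2 * ((m - G.degree v - n + 2) - (n - 2) / 2) ≤
        ({H : (G.induce {u | u ≠ v}).Subgraph | IsCycleSubgraph H}.ncard : ℝ) := by
    intro v
    have h := hG.mul_le_two_mul_ncard v
    rw [← hn, ← hm] at h
    nlinarith [sq_nonneg ((m - G.degree v - n + 2) - (n - 2) / 2)]
  refine le_trans ?_ (Finset.sum_le_sum fun v _ => htangent v)
  have hsum : ∑ v : V, ((n - 2) * n / 8 + (n - 1) / 2 *
      ((m - G.degree v - n + 2) - (n - 2) / 2)) =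
      n * ((n - 2) * n / 8) + (n - 1) / 2 * (n * (m - n + 2 - (n - 2) / 2) - 2 * m) := by
    rw [Finset.sum_add_distrib, ← Finset.mul_sum, ← hdeg]
    simp only [Finset.sum_sub_distrib, Finset.sum_add_distrib, Finset.sum_const, Finset.card_univ,
      nsmul_eq_mul, ← hn]
    ring
  rw [hsum]
  have hprod : 0 ≤ (n - 1) / 2 * ((n - 2) * (m - 3 * n / 2)) :=
    mul_nonneg (by linarith) (mul_nonneg (by linarith) (by linarith))
  nlinarith
end

section
/- Let G be a 3-connected graph with n vertices, m edges and vertex degrees d_1,...,d_n. Then the number of distinct K4-subdivisions contained in G is at least (1/4)·∑_{i=1}^{n} binom(m − d_i − n + 3, 2). -/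
open SimpleGraph

variable {V : Type*}

/-- A finite-dimensional space of functions has a basis dual to evaluation at some points. -/
theorem exists_dual_coordinates {K E : Type*} [Field K] [Finite E] (W : Submodule K (E → K)) :
    ∃ (C : Fin (Module.finrank K W) → E → K) (p : Fin (Module.finrank K W) → E),
      (∀ i, C i ∈ W) ∧ (∀ i, C i (p i) = 1) ∧ (∀ i j, i ≠ j → C i (p j) = 0) ∧
      ∀ w ∈ W, w = ∑ i, w (p i) • C i := by
  classical
  let φ : E → Module.Dual K W := fun e => (LinearMap.proj e) ∘ₗ W.subtype
  have hspan : Submodule.span K (Set.range φ) = ⊤ := by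
    have h : (Submodule.span K (Set.range φ)).dualCoannihilator = ⊥ := by
      rw [eq_bot_iff]
      intro w hw
      rw [Submodule.mem_dualCoannihilator] at hw
      rw [Submodule.mem_bot]
      ext e
      exact hw (φ e) (Submodule.subset_span ⟨e, rfl⟩)
    rw [← Subspace.dualCoannihilator_dualAnnihilator_eq (W := Submodule.span K (Set.range φ)), h]
    simp
  obtain ⟨b, hbs, hbspan, hbli⟩ := exists_linearIndependent K (Set.range φ)
  rw [hspan] at hbspan
  let B' : Module.Basis b K (Module.Dual K W) := Module.Basis.mk hbli (by simp [hbspan])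
  have : Fintype b := FiniteDimensional.fintypeBasisIndex B'
  let B : Module.Basis (Fin (Module.finrank K W)) K (Module.Dual K W) :=
    B'.reindex (Fintype.equivFinOfCardEq
      (by rw [← Module.finrank_eq_card_basis B', Subspace.dual_finrank_eq]))
  have hBφ : ∀ j, ∃ e, φ e = B j := fun j => by
    simp only [B, B', Module.Basis.reindex_apply, Module.Basis.mk_apply]
    exact hbs (Subtype.coe_prop _)
  choose p hp using hBφ
  let c : Fin (Module.finrank K W) → W := fun i => (Module.evalEquiv K W).symm (B.coord i)
  have hc : ∀ i (f : Module.Dual K W), f (c i) = B.coord i f := by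
    intro i f
    simp [c]
  have hcp : ∀ i j, (c i : E → K) (p j) = if j = i then 1 else 0 := by
    intro i j
    have := hc i (φ (p j))
    rw [hp, Module.Basis.coord_apply, B.repr_self, Finsupp.single_apply, ← hp] at this
    exact this
  refine ⟨fun i => c i, p, fun i => (c i).2, fun i => by simp [hcp],
    fun i j h => by simp [hcp, h.symm], fun w hw => ?_⟩
  have : (⟨w, hw⟩ : W) = ∑ i, w (p i) • c i := by
    rw [← sub_eq_zero, ← Module.forall_dual_apply_eq_zero_iff K]
    suffices h : Module.Dual.eval K W (⟨w, hw⟩ - ∑ i, w (p i) • c i) = 0 from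
      fun f => LinearMap.congr_fun h f
    refine B.ext fun j => ?_
    rw [← hp]
    simp [φ, hcp]
  simpa using congrArg Subtype.val this

/-- A circuit of a space of functions: a nonzero member of minimal support. -/
def IsCircuitOf {K E : Type*} [Field K] (W : Submodule K (E → K)) (c : E → K) : Prop :=
  c ∈ W ∧ c ≠ 0 ∧ ∀ w ∈ W, w ≠ 0 → (∀ e, c e = 0 → w e = 0) → w = c

theorem adj_getVert_iff_of_length_eq_dist {α : Type*} {Γ : SimpleGraph α} (hΓ : Γ.Connected)
    {i j : α} (P : Γ.Walk i j) (hP : P.length = Γ.dist i j) {a b : ℕ} (ha : a ≤ P.length)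
    (hb : b ≤ P.length) (h : Γ.Adj (P.getVert a) (P.getVert b)) : a = b + 1 ∨ b = a + 1 := by
  have key : ∀ n ≤ P.length, Γ.dist i (P.getVert n) = n := fun n hn => by
    rw [← length_eq_dist_of_subwalk hP (P.isSubwalk_take n), Walk.take_length]
    omega
  have hne : a ≠ b := fun hab => h.ne (by rw [hab])
  have h1 := hΓ.dist_triangle (u := i) (v := P.getVert a) (w := P.getVert b)
  have h2 := hΓ.dist_triangle (u := i) (v := P.getVert b) (w := P.getVert a)
  rw [SimpleGraph.dist_eq_one_iff_adj.2 h] at h1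
  rw [SimpleGraph.dist_eq_one_iff_adj.2 h.symm] at h2
  rw [key a ha, key b hb] at h1 h2
  omega

theorem mem_endpoints_iff_of_length_eq_dist {α : Type*} {Γ : SimpleGraph α} (hΓ : Γ.Connected)
    {i j : α} (P : Γ.Walk i j) (hP : P.length = Γ.dist i j) (x : α) :
    x ∈ s(i, j) ↔ x ∈ P.support ∧
      ∀ y ∈ P.support, ∀ z ∈ P.support, Γ.Adj x y → Γ.Adj x z → y = z := by
  have hinj := (P.isPath_of_length_eq_dist hP).getVert_injOn
  rw [Sym2.mem_iff]
  constructor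
  · intro hx
    have hx' : x = P.getVert 0 ∨ x = P.getVert P.length := by simpa using hx
    refine ⟨by rcases hx with rfl | rfl <;> simp, fun y hy z hz hxy hxz => ?_⟩
    obtain ⟨b, rfl, hb⟩ := Walk.mem_support_iff_exists_getVert.1 hy
    obtain ⟨c, rfl, hc⟩ := Walk.mem_support_iff_exists_getVert.1 hz
    rcases hx' with rfl | rfl
    · have h1 := adj_getVert_iff_of_length_eq_dist hΓ P hP (by omega) hb hxy
      have h2 := adj_getVert_iff_of_length_eq_dist hΓ P hP (by omega) hc hxz
      congr 1
      omega
    · have h1 := adj_getVert_iff_of_length_eq_dist hΓ P hP le_rfl hb hxy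
      have h2 := adj_getVert_iff_of_length_eq_dist hΓ P hP le_rfl hc hxz
      congr 1
      omega
  · rintro ⟨hx, h⟩
    obtain ⟨a, rfl, ha⟩ := Walk.mem_support_iff_exists_getVert.1 hx
    by_contra hne
    have h0 : a ≠ 0 := fun h => hne (Or.inl (by simp [h]))
    have h1 : a ≠ P.length := fun h => hne (Or.inr (by simp [h]))
    obtain ⟨d, rfl⟩ := Nat.exists_eq_succ_of_ne_zero h0
    have := h (P.getVert d) (P.getVert_mem_support _) (P.getVert (d + 2)) (P.getVert_mem_support _)
      (P.adj_getVert_succ (by omega)).symm (P.adj_getVert_succ (by omega))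
    have := hinj (show d ≤ P.length by omega) (show d + 2 ≤ P.length by omega) this
    omega

/-- The graph on the index set of a family of functions recording which supports meet. -/
def supportGraph {E ι : Type*} (C : ι → E → ZMod 2) : SimpleGraph ι :=
  SimpleGraph.fromRel fun i j => ∃ e, C i e ≠ 0 ∧ C j e ≠ 0

theorem supportGraph_adj {E ι : Type*} {C : ι → E → ZMod 2} {i j : ι} :
    (supportGraph C).Adj i j ↔ i ≠ j ∧ ∃ e, C i e ≠ 0 ∧ C j e ≠ 0 := by
  simp only [supportGraph, SimpleGraph.fromRel_adj]
  refine and_congr_right fun _ => ⟨?_, Or.inl⟩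
  rintro (h | ⟨e, h1, h2⟩)
  · exact h
  · exact ⟨e, h2, h1⟩

theorem sum_apply_of_dual {E ι : Type*} [Fintype ι] [DecidableEq ι] {C : ι → E → ZMod 2}
    {p : ι → E} (h1 : ∀ i, C i (p i) = 1) (h0 : ∀ i j, i ≠ j → C i (p j) = 0) (S : Finset ι)
    (i : ι) : (∑ k ∈ S, C k) (p i) = if i ∈ S then 1 else 0 := by
  rw [Finset.sum_apply]
  split_ifs with h
  · rw [Finset.sum_eq_single_of_mem i h fun k _ hk => h0 k i hk, h1]
  · exact Finset.sum_eq_zero fun k hk => h0 k i fun hki => h (hki ▸ hk)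

theorem isCircuitOf_sum_geodesic {E ι : Type*} [Fintype ι] [DecidableEq ι]
    {W : Submodule (ZMod 2) (E → ZMod 2)} {C : ι → E → ZMod 2}
    {p : ι → E} (hW : ∀ i, C i ∈ W) (h1 : ∀ i, C i (p i) = 1)
    (h0 : ∀ i j, i ≠ j → C i (p j) = 0) (hrep : ∀ w ∈ W, w = ∑ i, w (p i) • C i)
    (hΓ : (supportGraph C).Connected) {i j : ι} (P : (supportGraph C).Walk i j)
    (hP : P.length = (supportGraph C).dist i j) :
    IsCircuitOf W (∑ k ∈ P.support.toFinset, C k) := by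
  have hval := sum_apply_of_dual h1 h0 P.support.toFinset
  refine ⟨W.sum_mem fun k _ => hW k, fun h => ?_, fun w hw hw0 hsupp => ?_⟩
  · have := hval i
    rw [h] at this
    simp at this
  have z2 : ∀ x : ZMod 2, x ≠ 0 → x = 1 := by decide
  have hcW : ∑ k ∈ P.support.toFinset, C k ∈ W := W.sum_mem fun k _ => hW k
  have hinj := (P.isPath_of_length_eq_dist hP).getVert_injOn
  have huoff : ∀ u : E → ZMod 2, (∀ e, (∑ k ∈ P.support.toFinset, C k) e = 0 → u e = 0) →
      ∀ k, k ∉ P.support → u (p k) = 0 := fun u hus k hk => hus _ (by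
    rw [hval, if_neg (by simpa using hk)])
  have key : ∀ a < P.length, ∃ e, ∀ u ∈ W,
      (∀ e, (∑ k ∈ P.support.toFinset, C k) e = 0 → u e = 0) →
      u e = u (p (P.getVert a)) + u (p (P.getVert (a + 1))) := by
    intro a ha
    have hadj := P.adj_getVert_succ ha
    obtain ⟨hne, e, he1, he2⟩ := supportGraph_adj.1 hadj
    have hother : ∀ k ∈ P.support, k ≠ P.getVert a → k ≠ P.getVert (a + 1) → C k e = 0 := by
      intro k hk hka hkb
      by_contra hke
      obtain ⟨b, rfl, hb⟩ := Walk.mem_support_iff_exists_getVert.1 hk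
      have e1 := adj_getVert_iff_of_length_eq_dist hΓ P hP hb ha.le
        (supportGraph_adj.2 ⟨hka, e, hke, he1⟩)
      have e2 := adj_getVert_iff_of_length_eq_dist hΓ P hP hb (by omega)
        (supportGraph_adj.2 ⟨hkb, e, hke, he2⟩)
      omega
    refine ⟨e, fun u hu hus => ?_⟩
    conv_lhs => rw [hrep u hu]
    rw [Finset.sum_apply, ← Finset.sum_subset (Finset.subset_univ
      {P.getVert a, P.getVert (a + 1)}), Finset.sum_pair hne]
    · simp [z2 _ he1, z2 _ he2]
    · intro k _ hk
      simp only [Finset.mem_insert, Finset.mem_singleton, not_or] at hk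
      by_cases hks : k ∈ P.support
      · simp [hother k hks hk.1 hk.2]
      · simp [huoff u hus k hks]
  have hstep : ∀ a < P.length, w (p (P.getVert a)) = w (p (P.getVert (a + 1))) := by
    intro a ha
    obtain ⟨e, he⟩ := key a ha
    have hce := he _ hcW fun _ h => h
    rw [hval, hval, if_pos (by simp), if_pos (by simp)] at hce
    have hwe := he w hw hsupp
    rw [hsupp e (hce.trans (by decide))] at hwe
    exact (CharTwo.add_eq_zero.1 hwe.symm)
  have hconst : ∀ a ≤ P.length, w (p (P.getVert a)) = w (p i) := by
    intro a
    induction a with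
    | zero => simp
    | succ a ih => exact fun ha => (hstep a (by omega)).symm.trans (ih (by omega))
  have hwi : w (p i) = 1 := by
    refine z2 _ fun h => hw0 ?_
    rw [hrep w hw]
    refine Finset.sum_eq_zero fun k _ => ?_
    by_cases hk : k ∈ P.support
    · obtain ⟨a, rfl, ha⟩ := Walk.mem_support_iff_exists_getVert.1 hk
      rw [hconst a ha, h, zero_smul]
    · rw [huoff w hsupp k hk, zero_smul]
  rw [hrep w hw, ← Finset.sum_subset (Finset.subset_univ P.support.toFinset)]
  · refine Finset.sum_congr rfl fun k hk => ?_
    obtain ⟨a, rfl, ha⟩ := Walk.mem_support_iff_exists_getVert.1 (List.mem_toFinset.1 hk)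
    rw [hconst a ha, hwi, one_smul]
  · intro k _ hk
    rw [huoff w hsupp k (by simpa using hk), zero_smul]

/-- A space of functions is indecomposable if restricting its members to a set of coordinates
only preserves the space when that set contains no, or every, support. -/
def Indecomposable {E : Type*} (W : Submodule (ZMod 2) (E → ZMod 2)) : Prop :=
  ∀ A : Set E, (∀ w ∈ W, A.indicator w ∈ W) →
    (∃ w ∈ W, ∃ e ∈ A, w e ≠ 0) → ∀ w ∈ W, ∀ e, w e ≠ 0 → e ∈ A

theorem supportGraph_connected {E ι : Type*} [Fintype ι] [Nonempty ι]
    {W : Submodule (ZMod 2) (E → ZMod 2)} {C : ι → E → ZMod 2} {p : ι → E}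
    (hW : ∀ i, C i ∈ W) (h1 : ∀ i, C i (p i) = 1)
    (hrep : ∀ w ∈ W, w = ∑ i, w (p i) • C i) (hI : Indecomposable W) :
    (supportGraph C).Connected := by
  classical
  refine ⟨fun i j => ?_⟩
  let A : Set E := {e | ∃ k, (supportGraph C).Reachable i k ∧ C k e ≠ 0}
  have hA : ∀ k, (supportGraph C).Reachable i k → A.indicator (C k) = C k := by
    intro k hk
    refine Set.indicator_eq_self.2 fun e he => ⟨k, hk, he⟩
  have hA' : ∀ k, ¬ (supportGraph C).Reachable i k → A.indicator (C k) = 0 := by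
    intro k hk
    refine Set.indicator_eq_zero.2 (Set.disjoint_left.2 ?_)
    rintro e he ⟨l, hl, hle⟩
    by_cases hlk : l = k
    · exact hk (hlk ▸ hl)
    · exact hk (hl.trans (supportGraph_adj.2 ⟨hlk, e, hle, he⟩).reachable)
  have hsep : ∀ w ∈ W, A.indicator w ∈ W := by
    intro w hw
    rw [hrep w hw, Finset.indicator_sum]
    refine W.sum_mem fun k _ => ?_
    have hsmul : A.indicator (w (p k) • C k) = w (p k) • A.indicator (C k) := by
      ext e
      by_cases he : e ∈ A <;> simp [he]
    rw [hsmul]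
    refine W.smul_mem _ ?_
    by_cases hk : (supportGraph C).Reachable i k
    · rw [hA k hk]; exact hW k
    · rw [hA' k hk]; exact W.zero_mem
  have hj := hI A hsep ⟨C i, hW i, p i, ⟨i, .rfl, by simp [h1]⟩, by simp [h1]⟩ (C j) (hW j) (p j)
    (by simp [h1])
  by_contra hij
  have := congrFun (hA' j hij) (p j)
  rw [Set.indicator_of_mem hj] at this
  simp [h1] at this

/-- An indecomposable binary space of dimension `k` has at least `(k + 1).choose 2` circuits. -/
theorem choose_two_le_ncard_isCircuitOf {E : Type*} [Finite E]
    {W : Submodule (ZMod 2) (E → ZMod 2)} (hI : Indecomposable W) :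
    (Module.finrank (ZMod 2) W + 1).choose 2 ≤ {c | IsCircuitOf W c}.ncard := by
  classical
  obtain ⟨C, p, hW, h1, h0, hrep⟩ := exists_dual_coordinates W
  rcases Nat.eq_zero_or_pos (Module.finrank (ZMod 2) W) with hz | hpos
  · simp [hz]
  have : Nonempty (Fin (Module.finrank (ZMod 2) W)) := ⟨⟨0, hpos⟩⟩
  have hΓ := supportGraph_connected hW h1 hrep hI
  have hP : ∀ s : Sym2 (Fin (Module.finrank (ZMod 2) W)), ∃ c, IsCircuitOf W c ∧
      ∀ x, x ∈ s ↔ c (p x) = 1 ∧ ∀ y, c (p y) = 1 → ∀ z, c (p z) = 1 →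
        (supportGraph C).Adj x y → (supportGraph C).Adj x z → y = z := by
    intro s
    induction s with | h i j =>
    obtain ⟨P, hP⟩ := hΓ.exists_walk_length_eq_dist i j
    refine ⟨_, isCircuitOf_sum_geodesic hW h1 h0 hrep hΓ P hP, fun x => ?_⟩
    simp only [sum_apply_of_dual h1 h0, List.mem_toFinset, ite_eq_left_iff, zero_ne_one,
      imp_false, not_not]
    exact mem_endpoints_iff_of_length_eq_dist hΓ P hP x
  choose c hc hcs using hP
  have hinj : Function.Injective c := fun s t hst => Sym2.ext fun x => by rw [hcs, hcs, hst]
  calc _ = Fintype.card (Sym2 (Fin (Module.finrank (ZMod 2) W))) := by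
        rw [Sym2.card, Fintype.card_fin]
    _ = (Set.range c).ncard := by
        rw [← Set.image_univ, Set.ncard_image_of_injective _ hinj, Set.ncard_univ,
          Nat.card_eq_fintype_card]
    _ ≤ _ := Set.ncard_le_ncard (by rintro _ ⟨s, rfl⟩; exact hc s) (Set.toFinite _)

/-- The cycle space of `G` over `ZMod 2`. -/
def cycleSpace [Fintype V] (G : SimpleGraph V) : Submodule (ZMod 2) (Sym2 V → ZMod 2) where
  carrier := {f | (∀ e ∉ G.edgeSet, f e = 0) ∧ ∀ x, ∑ y, f s(x, y) = 0}
  zero_mem' := by simp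
  add_mem' := by
    rintro f g ⟨hf, hf'⟩ ⟨hg, hg'⟩
    exact ⟨fun e he => by simp [hf e he, hg e he],
      fun x => by simp [Finset.sum_add_distrib, hf', hg']⟩
  smul_mem' := by
    rintro a f ⟨hf, hf'⟩
    exact ⟨fun e he => by simp [hf e he], fun x => by simp [← Finset.mul_sum, hf']⟩

theorem sum_sum_sym2_eq_zero [Fintype V] {f : Sym2 V → ZMod 2} (hf : ∀ x, f s(x, x) = 0) :
    ∑ x, ∑ y, f s(x, y) = 0 := by
  rw [← Finset.sum_product']
  refine Finset.sum_involution (fun a _ => a.swap) ?_ ?_ (by simp) (by simp)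
  · rintro ⟨x, y⟩ -
    simp only [Prod.swap, Sym2.eq_swap (a := y)]
    exact CharTwo.add_self_eq_zero _
  · rintro ⟨x, y⟩ - h h'
    simp only [Prod.swap, Prod.mk.injEq] at h'
    exact h (by simp [h'.1, hf])

theorem card_edgeFinset_le_finrank_cycleSpace_add [Fintype V] [DecidableEq V] (G : SimpleGraph V)
    [DecidableRel G.Adj] {u v : V} (huv : u ≠ v) (hv : ∀ x, ¬ G.Adj v x) :
    G.edgeFinset.card + 2 ≤ Module.finrank (ZMod 2) (cycleSpace G) + Fintype.card V := by
  let D : (Sym2 V → ZMod 2) →ₗ[ZMod 2]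
      ({x // x ∉ ({u, v} : Finset V)} → ZMod 2) × ({e // e ∉ G.edgeFinset} → ZMod 2) :=
    LinearMap.prod
      (LinearMap.pi fun x => ∑ y, LinearMap.proj s(x.1, y))
      (LinearMap.pi fun e => LinearMap.proj e.1)
  have hker : LinearMap.ker D ≤ cycleSpace G := by
    intro f hf
    rw [LinearMap.mem_ker] at hf
    have h1 : ∀ x, x ≠ u → x ≠ v → ∑ y, f s(x, y) = 0 := by
      intro x hxu hxv
      have := congrFun (congrArg Prod.fst hf) ⟨x, by simp [hxu, hxv]⟩
      simpa [D] using this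
    have h2 : ∀ e ∉ G.edgeSet, f e = 0 := by
      intro e he
      exact congrFun (congrArg Prod.snd hf) ⟨e, by simpa using he⟩
    have h3 : ∑ y, f s(v, y) = 0 := Finset.sum_eq_zero fun y _ => h2 _ (by simpa using hv y)
    refine ⟨h2, fun x => ?_⟩
    by_cases hxv : x = v
    · rw [hxv, h3]
    by_cases hxu : x = u
    · have := sum_sum_sym2_eq_zero (f := f) fun x => h2 _ (by simp)
      rw [Finset.sum_eq_single u] at this
      · rw [hxu, this]
      · intro b _ hb
        by_cases hbv : b = v
        · rw [hbv, h3]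
        · exact h1 b hb hbv
      · simp
    · exact h1 x hxu hxv
  have hrank := D.finrank_range_add_finrank_ker
  have hle := Submodule.finrank_mono hker
  have hrange := Submodule.finrank_le (LinearMap.range D)
  rw [Module.finrank_prod, Module.finrank_fintype_fun_eq_card, Module.finrank_fintype_fun_eq_card]
    at hrange
  rw [Module.finrank_fintype_fun_eq_card] at hrank
  have c1 := Fintype.card_subtype_compl (fun x => x ∈ ({u, v} : Finset V))
  have c2 := Fintype.card_subtype_compl (fun e => e ∈ G.edgeFinset)
  rw [Fintype.card_coe] at c1 c2
  rw [Finset.card_pair huv] at c1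
  have c3 := Finset.card_le_univ ({u, v} : Finset V)
  have c4 := Finset.card_le_univ G.edgeFinset
  rw [Finset.card_pair huv] at c3
  omega

theorem sum_single_sym2 [Fintype V] [DecidableEq V] {a c : V} (hne : a ≠ c) (x : V) :
    ∑ y, (Pi.single s(a, c) 1 : Sym2 V → ZMod 2) s(x, y) =
      (if x = a then 1 else 0) + if x = c then 1 else 0 := by
  simp only [Pi.single_apply, Sym2.eq_iff]
  by_cases hxa : x = a
  · have : x ≠ c := hxa ▸ hne
    simp [hxa, hne]
  · by_cases hxc : x = c
    · simp [hxc, hne.symm]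
    · simp [hxa, hxc]

/-- Two vertices outside `S` are joined by a binary chain of edges avoiding `S`. -/
theorem exists_pathChain [Fintype V] [DecidableEq V] {G : SimpleGraph V} {S : Set V} {a b : V}
    (ha : a ∉ S) (hb : b ∉ S) (h : (G.induce Sᶜ).Connected) :
    ∃ f : Sym2 V → ZMod 2, (∀ e ∉ G.edgeSet, f e = 0) ∧ (∀ e, ∀ w ∈ S, w ∈ e → f e = 0) ∧
      ∀ x, ∑ y, f s(x, y) = (if x = a then 1 else 0) + if x = b then 1 else 0 := by
  obtain ⟨P⟩ := h.preconnected ⟨a, ha⟩ ⟨b, hb⟩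
  suffices H : ∀ (a b : ↥Sᶜ) (_ : (G.induce Sᶜ).Walk a b),
      ∃ f : Sym2 V → ZMod 2, (∀ e ∉ G.edgeSet, f e = 0) ∧ (∀ e, ∀ w ∈ S, w ∈ e → f e = 0) ∧
      ∀ x, ∑ y, f s(x, y) = (if x = a then 1 else 0) + if x = b then 1 else 0 from H _ _ P
  intro a b P
  induction P with
  | nil => exact ⟨0, by simp, by simp, fun x => by simp [CharTwo.add_self_eq_zero]⟩
  | @cons a c b hac P ih =>
    obtain ⟨f, hf1, hf2, hf3⟩ := ih
    have hG : G.Adj a c := hac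
    refine ⟨f + Pi.single s(a.1, c.1) 1, fun e he => ?_, fun e w hw hwe => ?_, fun x => ?_⟩
    · have : e ≠ s(a.1, c.1) := fun h => he (by rw [h]; exact hG)
      simp [hf1 e he, this]
    · have : e ≠ s(a.1, c.1) := by
        rintro rfl
        rcases Sym2.mem_iff.1 hwe with rfl | rfl
        · exact a.2 hw
        · exact c.2 hw
      simp [hf2 e w hw hwe, this]
    · simp only [Pi.add_apply, Finset.sum_add_distrib, hf3]
      rw [sum_single_sym2 hG.ne]
      have hcancel : ∀ p q r : ZMod 2, p + q + (r + p) = r + q := by decide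
      exact hcancel _ _ _

theorem indecomposable_cycleSpace [Fintype V] {K : SimpleGraph V} {v : V}
    (h0 : ∀ x, ¬ K.Adj v x) (h1 : (K.induce {v}ᶜ).Connected)
    (h2 : ∀ w, w ≠ v → (K.induce {v, w}ᶜ).Connected) : Indecomposable (cycleSpace K) := by
  classical
  have hv : ∀ {x y}, K.Adj x y → x ≠ v := by
    rintro x y hxy rfl
    exact h0 _ hxy
  rintro A hA ⟨w₀, hw₀, e₀, he₀A, he₀⟩ w hw e he
  have hswitch : ∀ x a b, K.Adj x a → s(x, a) ∈ A → K.Adj x b → s(x, b) ∈ A := by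
    intro x a b hxa hA' hxb
    by_contra hxbA
    have hab : a ≠ b := by rintro rfl; exact hxbA hA'
    obtain ⟨f, hf1, hf2, hf3⟩ := exists_pathChain (G := K) (S := {v, x}) (a := a) (b := b)
      (by simp [hv hxa.symm, hxa.ne.symm]) (by simp [hv hxb.symm, hxb.ne.symm]) (h2 x (hv hxa))
    have hc : f + Pi.single s(x, a) 1 + Pi.single s(x, b) 1 ∈ cycleSpace K := by
      refine ⟨fun e he => ?_, fun y => ?_⟩
      · have e1 : e ≠ s(x, a) := fun h => he (by rw [h]; exact hxa)
        have e2 : e ≠ s(x, b) := fun h => he (by rw [h]; exact hxb)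
        simp [hf1 e he, e1, e2]
      · simp only [Pi.add_apply, Finset.sum_add_distrib, hf3, sum_single_sym2 hxa.ne,
          sum_single_sym2 hxb.ne]
        have z : ∀ p q r : ZMod 2, p + q + (r + p) + (r + q) = 0 := by decide
        exact z _ _ _
    have := (hA _ hc).2 x
    rw [Finset.sum_eq_single a] at this
    · rw [Set.indicator_of_mem hA'] at this
      have e2 : s(x, a) ≠ s(x, b) := fun h => hab (Sym2.congr_right.1 h)
      simp [hf2 s(x, a) x (by simp) (by simp), e2] at this
    · intro y _ hy
      by_cases hyA : s(x, y) ∈ A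
      · rw [Set.indicator_of_mem hyA]
        have hyb : y ≠ b := by rintro rfl; exact hxbA hyA
        have e1 : s(x, y) ≠ s(x, a) := fun h => hy (Sym2.congr_right.1 h)
        have e2 : s(x, y) ≠ s(x, b) := fun h => hyb (Sym2.congr_right.1 h)
        simp [hf2 s(x, y) x (by simp) (by simp), e1, e2]
      · rw [Set.indicator_of_notMem hyA]
    · simp
  have hedge : ∀ w ∈ cycleSpace K, ∀ e, w e ≠ 0 → e ∈ K.edgeSet := fun w hw e he => by
    by_contra h
    exact he (hw.1 e h)
  have hmem₀ := hedge w₀ hw₀ e₀ he₀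
  have hmem := hedge w hw e he
  clear he he₀
  induction e₀ with | h x₀ y₀ =>
  induction e with | h x y =>
  rw [mem_edgeSet] at hmem₀ hmem
  obtain ⟨P⟩ := h1.preconnected ⟨x₀, hv hmem₀⟩ ⟨x, hv hmem⟩
  suffices H : ∀ (a b : ↥({v}ᶜ : Set V)) (_ : (K.induce {v}ᶜ).Walk a b),
      (∀ z, K.Adj a z → s(a.1, z) ∈ A) → ∀ z, K.Adj b z → s(b.1, z) ∈ A from
    H _ _ P (fun z hz => hswitch _ _ _ hmem₀ he₀A hz) _ hmem
  intro a b P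
  induction P with
  | nil => exact id
  | @cons a c b hac P ih =>
    intro ha
    have hac' : K.Adj a c := hac
    refine ih fun z hz => hswitch _ _ _ hac'.symm ?_ hz
    rw [Sym2.eq_swap]
    exact ha _ hac'

theorem exists_isCycle_of_mem_cycleSpace [Fintype V] {K : SimpleGraph V} {c : Sym2 V → ZMod 2}
    (hc : c ∈ cycleSpace K) (hc0 : c ≠ 0) :
    ∃ (x : V) (p : K.Walk x x), p.IsCycle ∧ ∀ e ∈ p.edges, c e ≠ 0 := by
  classical
  let F : SimpleGraph V := SimpleGraph.fromEdgeSet {e | c e ≠ 0}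
  have hFK : F ≤ K := by
    intro x y h
    by_contra hxy
    exact ((SimpleGraph.fromEdgeSet_adj _).1 h).1 (hc.1 _ hxy)
  suffices h : ¬ F.IsAcyclic by
    simp only [SimpleGraph.IsAcyclic, not_forall, not_not] at h
    obtain ⟨x, p, hp⟩ := h
    refine ⟨x, p.mapLe hFK, hp.mapLe hFK, fun e he => ?_⟩
    rw [Walk.edges_mapLe_eq_edges] at he
    have := p.edges_subset_edgeSet he
    rw [SimpleGraph.edgeSet_fromEdgeSet] at this
    exact this.1
  intro hF
  obtain ⟨e, he⟩ := Function.ne_iff.1 hc0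
  have heK : e ∈ K.edgeSet := by
    by_contra h
    exact he (hc.1 e h)
  induction e with | h x y =>
  have hxy : F.Adj x y := (SimpleGraph.fromEdgeSet_adj _).2 ⟨he, heK.ne⟩
  have hbr := (isAcyclic_iff_forall_adj_isBridge.1 hF) hxy
  rw [isBridge_iff] at hbr
  have z2 : ∀ a : ZMod 2, a ≠ 0 → a = 1 := by decide
  let R : Set V := {z | (F.deleteEdges {s(x, y)}).Reachable x z}
  let g : Sym2 V → ZMod 2 := fun e => if e ≠ s(x, y) ∧ ∀ z ∈ e, z ∈ R then c e else 0
  have hg : ∀ z, ∑ t, g s(z, t) = if z = x then 1 else 0 := by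
    intro z
    by_cases hz : z ∈ R
    · have hzy : z ≠ y := by
        rintro rfl
        exact hbr hz
      have hsum : ∑ t, c s(z, t) =
          ∑ t, (g s(z, t) + (Pi.single s(x, y) 1 : Sym2 V → ZMod 2) s(z, t)) := by
        refine Finset.sum_congr rfl fun t _ => ?_
        by_cases h1 : s(z, t) = s(x, y)
        · simp [g, h1, z2 _ he]
        · by_cases h2 : c s(z, t) = 0
          · simp [g, h2, h1]
          · have ht : t ∈ R := by
              refine Reachable.trans hz (Adj.reachable ?_)
              rw [deleteEdges_adj]
              refine ⟨(SimpleGraph.fromEdgeSet_adj _).2 ⟨h2, ?_⟩, h1⟩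
              rintro rfl
              exact h2 (hc.1 _ (by simp))
            simp only [g]
            rw [if_pos ⟨h1, by simp [hz, ht]⟩]
            simp [h1]
      rw [hc.2 z, Finset.sum_add_distrib, sum_single_sym2 hxy.ne, if_neg hzy, add_zero] at hsum
      exact CharTwo.add_eq_zero.1 hsum.symm
    · have hzx : z ≠ x := by
        rintro rfl
        exact hz (Reachable.refl _)
      rw [if_neg hzx]
      refine Finset.sum_eq_zero fun t _ => ?_
      simp only [g]
      rw [if_neg fun h => hz (h.2 z (by simp))]
  have h0 := sum_sum_sym2_eq_zero (f := g) fun z => by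
    simp [g, hc.1 s(z, z) (by simp)]
  simp [hg] at h0

theorem sum_count_edges [Fintype V] [DecidableEq V] {K : SimpleGraph V} {a b : V}
    (p : K.Walk a b) (x : V) :
    ∑ y, (p.edges.count s(x, y) : ZMod 2) =
      (if x = a then 1 else 0) + if x = b then 1 else 0 := by
  induction p with
  | nil => simp [CharTwo.add_self_eq_zero]
  | @cons a c b h p ih =>
    have key : ∀ y, ((Walk.cons h p).edges.count s(x, y) : ZMod 2) =
        p.edges.count s(x, y) + (Pi.single s(a, c) 1 : Sym2 V → ZMod 2) s(x, y) := by
      intro y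
      rw [Walk.edges_cons, List.count_cons, Pi.single_apply]
      push_cast
      simp only [beq_iff_eq, eq_comm (a := s(a, c))]
    rw [Finset.sum_congr rfl fun y _ => key y, Finset.sum_add_distrib, ih, sum_single_sym2 h.ne]
    have z : ∀ p q r : ZMod 2, p + q + (r + p) = r + q := by decide
    exact z _ _ _

theorem exists_isCycle_of_isCircuitOf [Fintype V] {K : SimpleGraph V} {c : Sym2 V → ZMod 2}
    (hc : IsCircuitOf (cycleSpace K) c) :
    ∃ (x : V) (p : K.Walk x x), p.IsCycle ∧ ∀ e, c e ≠ 0 ↔ e ∈ p.edges := by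
  classical
  obtain ⟨x, p, hp, hpc⟩ := exists_isCycle_of_mem_cycleSpace hc.1 hc.2.1
  refine ⟨x, p, hp, fun e => ⟨fun he => ?_, hpc e⟩⟩
  have h1 : ∀ e, (p.edges.count e : ZMod 2) ≠ 0 ↔ e ∈ p.edges := by
    intro e
    by_cases he : e ∈ p.edges
    · simp [List.count_eq_one_of_mem hp.edges_nodup he, he]
    · simp [List.count_eq_zero_of_not_mem he, he]
  have hw : (fun e => (p.edges.count e : ZMod 2)) ∈ cycleSpace K := by
    refine ⟨fun e he => ?_, fun y => ?_⟩
    · by_contra h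
      exact he (p.edges_subset_edgeSet ((h1 e).1 h))
    · rw [sum_count_edges, CharTwo.add_self_eq_zero]
  have hne : p.edges ≠ [] := by
    intro h
    exact hp.not_nil (Walk.edges_eq_nil.1 h)
  obtain ⟨e', he'⟩ := List.exists_mem_of_ne_nil _ hne
  have := hc.2.2 _ hw (fun h => (h1 e').2 he' (congrFun h e')) fun e he => by
    by_contra h
    exact hpc e ((h1 e).1 h) he
  rw [← this] at he
  exact (h1 e).1 he

theorem exists_walk_of_forall_adj {G : SimpleGraph V} (b : ℕ → V) (n : ℕ)
    (h : ∀ k < n, G.Adj (b k) (b (k + 1))) :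
    ∃ w : G.Walk (b 0) (b n), w.support = (List.range (n + 1)).map b := by
  induction n with
  | zero => exact ⟨Walk.nil, by simp⟩
  | succ n ih =>
    obtain ⟨w, hw⟩ := ih fun k hk => h k (by omega)
    refine ⟨w.concat (h n (by omega)), ?_⟩
    rw [Walk.support_concat, hw, List.range_succ (n := n + 1), List.map_append]
    simp

/-- A choice, by Hall's theorem, of successors for the vertices outside `X` and of three
neighbours of `v`, from which three disjoint paths are traced. -/
theorem exists_injective_neighbor_system [Fintype V] {G : SimpleGraph V}
    (hG : IsKConnected 3 G) {v : V} {X : Finset V} (hv : v ∉ X) (hX : 3 ≤ X.card) :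
    ∃ f : {u // u ∉ X ∧ u ≠ v} ⊕ Fin 3 → V, Function.Injective f ∧ (∀ k, f k ≠ v) ∧
      (∀ u, f (Sum.inl u) = u ∨ G.Adj u (f (Sum.inl u))) ∧ ∀ i, G.Adj v (f (Sum.inr i)) := by
  classical
  let t : {u // u ∉ X ∧ u ≠ v} ⊕ Fin 3 → Finset V :=
    Sum.elim (fun u => Finset.univ.filter fun y => y ≠ v ∧ (y = u ∨ G.Adj u y))
      (fun _ => Finset.univ.filter fun y => G.Adj v y)
  have hall := (Finset.all_card_le_biUnion_card_iff_exists_injective t).1 ?_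
  · obtain ⟨f, hf, hft⟩ := hall
    refine ⟨f, hf, ?_, ?_, ?_⟩
    · rintro (u | i)
      · have := hft (Sum.inl u)
        simp only [t, Sum.elim_inl, Finset.mem_filter] at this
        exact this.2.1
      · have := hft (Sum.inr i)
        simp only [t, Sum.elim_inr, Finset.mem_filter] at this
        exact this.2.ne'
    · intro u
      have := hft (Sum.inl u)
      simp only [t, Sum.elim_inl, Finset.mem_filter] at this
      exact this.2.2
    · intro i
      have := hft (Sum.inr i)
      simp only [t, Sum.elim_inr, Finset.mem_filter] at this
      exact this.2
  intro s
  let T : Finset V := s.toLeft.map (Function.Embedding.subtype _)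
  have hT : T.card = s.toLeft.card := Finset.card_map _
  have hTmem : ∀ y ∈ T, y ∉ X ∧ y ≠ v := by
    intro y hy
    obtain ⟨u, -, rfl⟩ := Finset.mem_map.1 hy
    exact u.2
  have hTN : T ⊆ s.biUnion t := by
    intro y hy
    obtain ⟨u, hu, rfl⟩ := Finset.mem_map.1 hy
    rw [Finset.mem_biUnion]
    exact ⟨Sum.inl u, by simpa using hu, by simp [t, u.2.2]⟩
  have hcard := Finset.card_toLeft_add_card_toRight (u := s)
  rcases s.toRight.eq_empty_or_nonempty with hJ | ⟨j, hj⟩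
  · rw [hJ, Finset.card_empty, ← hT] at hcard
    rw [← hcard]
    exact Finset.card_le_card hTN
  have hJ3 : s.toRight.card ≤ 3 := (Finset.card_le_univ _).trans (by simp)
  suffices hD : 3 ≤ (s.biUnion t \ T).card by
    rw [Finset.card_sdiff_of_subset hTN] at hD
    omega
  by_contra! hD
  have hconn := hG.2 _ hD
  obtain ⟨x, hx, hxD⟩ := Finset.exists_mem_notMem_of_card_lt_card (lt_of_lt_of_le hD hX)
  have hNv : v ∉ s.biUnion t := by
    rw [Finset.mem_biUnion]
    rintro ⟨u | i, -, h⟩ <;> simp [t] at h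
  have hclosed : ∀ a b, (a = v ∨ a ∈ T) → G.Adj a b → b ∉ s.biUnion t \ T → b = v ∨ b ∈ T := by
    intro a b ha hab hb
    by_cases hbv : b = v
    · exact Or.inl hbv
    refine Or.inr ?_
    by_contra hbT
    refine hb (Finset.mem_sdiff.2 ⟨Finset.mem_biUnion.2 ?_, hbT⟩)
    rcases ha with rfl | ha
    · exact ⟨Sum.inr j, by simpa using hj, by simpa [t] using hab⟩
    · obtain ⟨u, hu, rfl⟩ := Finset.mem_map.1 ha
      exact ⟨Sum.inl u, by simpa using hu, by simpa [t, hbv] using Or.inr hab⟩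
  obtain ⟨P⟩ := hconn.preconnected ⟨v, fun h => hNv (Finset.mem_sdiff.1 h).1⟩ ⟨x, hxD⟩
  suffices H : ∀ (a b : ↥((↑(s.biUnion t \ T) : Set V)ᶜ))
      (_ : (G.induce (↑(s.biUnion t \ T) : Set V)ᶜ).Walk a b),
      (a.1 = v ∨ a.1 ∈ T) → (b.1 = v ∨ b.1 ∈ T) by
    rcases H _ _ P (Or.inl rfl) with h | h
    · exact hv (h ▸ hx)
    · exact (hTmem _ h).1 hx
  intro a b P
  induction P with
  | nil => exact id
  | @cons a c b hac P ih => exact fun ha => ih (hclosed _ _ ha hac c.2)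

/-- In a 3-connected graph, three paths from `v` reach `X`, pairwise meeting only in `v`. -/
theorem exists_fan [Fintype V] {G : SimpleGraph V}
    (hG : IsKConnected 3 G) {v : V} {X : Finset V} (hv : v ∉ X) (hX : 3 ≤ X.card) :
    ∃ (x : Fin 3 → V) (Q : ∀ i, G.Walk v (x i)), (∀ i, x i ∈ X) ∧ (∀ i, (Q i).IsPath) ∧
      (∀ i, ∀ y ∈ (Q i).support, y ∈ X → y = x i) ∧
      ∀ i j, i ≠ j → ∀ y ∈ (Q i).support, y ∈ (Q j).support → y = v := by
  classical
  obtain ⟨f, hf, hfv, hfl, hfr⟩ := exists_injective_neighbor_system hG hv hX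
  let next : V → V := fun u => if h : u ∉ X ∧ u ≠ v then f (Sum.inl ⟨u, h⟩) else u
  let a : Fin 3 → ℕ → V := fun i n => next^[n] (f (Sum.inr i))
  have ha0 : ∀ i, a i 0 = f (Sum.inr i) := fun i => rfl
  have hav : ∀ i n, a i n ≠ v := by
    intro i n
    induction n with
    | zero => exact hfv _
    | succ n ih =>
      simp only [a, Function.iterate_succ_apply']
      change next (a i n) ≠ v
      simp only [next]
      split_ifs with h
      · exact hfv _
      · exact ih
  have hasucc : ∀ i n (h : a i n ∉ X), a i (n + 1) = f (Sum.inl ⟨a i n, h, hav i n⟩) := by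
    intro i n h
    simp only [a, Function.iterate_succ_apply']
    exact dif_pos ⟨h, hav i n⟩
  have hinj : ∀ n m i j, (∀ k < n, a i k ∉ X) → (∀ k < m, a j k ∉ X) → a i n = a j m →
      i = j ∧ n = m := by
    intro n
    induction n with
    | zero =>
      intro m i j _ hm h
      cases m with
      | zero => exact ⟨Sum.inr_injective (hf h), rfl⟩
      | succ m =>
        rw [hasucc j m (hm m (by omega)), ha0] at h
        cases hf h
    | succ n ih =>
      intro m i j hn hm h
      rw [hasucc i n (hn n (by omega))] at h
      cases m with
      | zero => cases hf h
      | succ m =>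
        rw [hasucc j m (hm m (by omega))] at h
        have := congrArg Subtype.val (Sum.inl_injective (hf h))
        obtain ⟨h1, h2⟩ := ih m i j (fun k hk => hn k (by omega)) (fun k hk => hm k (by omega)) this
        exact ⟨h1, by omega⟩
  have hex : ∀ i, ∃ n, a i n ∈ X := by
    intro i
    by_contra! h
    exact not_injective_infinite_finite (a i) fun n m hnm =>
      (hinj n m i i (fun k _ => h k) (fun k _ => h k) hnm).2
  let N : Fin 3 → ℕ := fun i => Nat.find (hex i)
  have hN : ∀ i, a i (N i) ∈ X := fun i => Nat.find_spec (hex i)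
  have hN' : ∀ i, ∀ k < N i, a i k ∉ X := fun i k hk => Nat.find_min (hex i) hk
  let b : Fin 3 → ℕ → V := fun i k => if k = 0 then v else a i (k - 1)
  have hb : ∀ i, ∀ k < N i + 1, G.Adj (b i k) (b i (k + 1)) := by
    intro i k hk
    cases k with
    | zero => exact hfr i
    | succ k =>
      have hkX := hN' i k (by omega)
      change G.Adj (a i k) (a i (k + 1))
      rcases hfl ⟨a i k, hkX, hav i k⟩ with h | h
      · rw [← hasucc i k hkX] at h
        have := (hinj (k + 1) k i i (fun l hl => hN' i l (by omega))
          (fun l hl => hN' i l (by omega)) h).2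
        omega
      · rwa [← hasucc i k hkX] at h
  choose Q hQ using fun i => exists_walk_of_forall_adj (b i) (N i + 1) (hb i)
  have hmem : ∀ i y, y ∈ (Q i).support ↔ y = v ∨ ∃ k ≤ N i, y = a i k := by
    intro i y
    rw [hQ, List.mem_map]
    constructor
    · rintro ⟨k, hk, rfl⟩
      rw [List.mem_range] at hk
      cases k with
      | zero => exact Or.inl rfl
      | succ k => exact Or.inr ⟨k, by omega, rfl⟩
    · rintro (rfl | ⟨k, hk, rfl⟩)
      · exact ⟨0, by simp, rfl⟩
      · exact ⟨k + 1, by simpa using by omega, rfl⟩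
  have hpath : ∀ i, (Q i).IsPath := by
    intro i
    rw [Walk.isPath_def, hQ]
    refine List.Nodup.map_on ?_ List.nodup_range
    intro k hk l hl hkl
    rw [List.mem_range] at hk hl
    cases k with
    | zero =>
      cases l with
      | zero => rfl
      | succ l => exact absurd hkl.symm (hav i l)
    | succ k =>
      cases l with
      | zero => exact absurd hkl (hav i k)
      | succ l =>
        have := (hinj k l i i (fun m hm => hN' i m (by omega)) (fun m hm => hN' i m (by omega))
          hkl).2
        omega
  refine ⟨fun i => a i (N i), Q, hN, hpath, fun i y hy hyX => ?_, fun i j hij y hy hy' => ?_⟩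
  · rcases (hmem i y).1 hy with rfl | ⟨k, hk, rfl⟩
    · exact absurd hyX hv
    · rcases hk.lt_or_eq with h | h
      · exact absurd hyX (hN' i k h)
      · rw [h]
  · rcases (hmem i y).1 hy with rfl | ⟨k, hk, rfl⟩
    · rfl
    rcases (hmem j _).1 hy' with h | ⟨l, hl, h⟩
    · exact h
    · exact absurd (hinj k l i j (fun m hm => hN' i m (by omega)) (fun m hm => hN' j m (by omega))
        h).1 hij

/-- Case analysis on the pairs `i < j` in `Fin 3`. -/
def finThreePairCases {motive : ∀ i j : Fin 3, i < j → Sort*} (h01 : motive 0 1 (by decide))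
    (h02 : motive 0 2 (by decide)) (h12 : motive 1 2 (by decide)) : ∀ i j h, motive i j h
  | 0, 1, _ => h01
  | 0, 2, _ => h02
  | 1, 2, _ => h12
  | 2, j, h => absurd h (by omega)

theorem exists_pairwise_walks {G : SimpleGraph V} {x : Fin 3 → V} (hx : Function.Injective x)
    {A : G.Walk (x 0) (x 1)} {B : G.Walk (x 1) (x 2)} {D : G.Walk (x 2) (x 0)}
    (hc : (A.append (B.append D)).IsCycle) :
    ∃ Q : ∀ i j : Fin 3, i < j → G.Walk (x i) (x j), (∀ i j h, (Q i j h).IsPath) ∧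
      (∀ e, e ∈ (A.append (B.append D)).edges ↔ ∃ i j h, e ∈ (Q i j h).edges) ∧
      ∀ i j h k l h', (i, j) ≠ (k, l) → ∀ z ∈ (Q i j h).support, z ∈ (Q k l h').support →
        (z = x i ∨ z = x j) ∧ (z = x k ∨ z = x l) := by
  have hnd := hc.support_nodup
  have h01 : x 0 ≠ x 1 := fun h => by cases hx h
  have h12 : x 1 ≠ x 2 := fun h => by cases hx h
  have h20 : x 2 ≠ x 0 := fun h => by cases hx h
  rw [Walk.tail_support_append, Walk.tail_support_append] at hnd
  have hA := A.cons_tail_support.symm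
  have hB := B.cons_tail_support.symm
  have hD := D.cons_tail_support.symm
  have h1A : x 1 ∈ A.support.tail := by
    have := A.end_mem_support; rw [hA, List.mem_cons] at this; grind
  have h2B : x 2 ∈ B.support.tail := by
    have := B.end_mem_support; rw [hB, List.mem_cons] at this; grind
  have h0D : x 0 ∈ D.support.tail := by
    have := D.end_mem_support; rw [hD, List.mem_cons] at this; grind
  have hAB : ∀ z ∈ A.support, z ∈ B.support → z = x 1 := by
    intro z; rw [hA, hB]; grind
  have hBD : ∀ z ∈ B.support, z ∈ D.support → z = x 2 := by
    intro z; rw [hB, hD]; grind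
  have hDA : ∀ z ∈ D.support, z ∈ A.support → z = x 0 := by
    intro z; rw [hA, hD]; grind
  have hpA : A.IsPath := by rw [Walk.isPath_def, hA]; grind
  have hpB : B.IsPath := by rw [Walk.isPath_def, hB]; grind
  have hpD : D.IsPath := by rw [Walk.isPath_def, hD]; grind
  have hDr : ∀ z, z ∈ D.reverse.support ↔ z ∈ D.support := by simp
  refine ⟨finThreePairCases A D.reverse B, finThreePairCases hpA hpD.reverse hpB, ?_, ?_⟩
  · intro e
    rw [Walk.edges_append, Walk.edges_append, List.mem_append, List.mem_append]
    constructor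
    · rintro (h | h | h)
      · exact ⟨0, 1, by decide, h⟩
      · exact ⟨1, 2, by decide, h⟩
      · exact ⟨0, 2, by decide, by simpa [finThreePairCases] using h⟩
    · rintro ⟨i, j, h, he⟩
      revert he
      refine finThreePairCases (motive := fun i j h =>
        e ∈ (finThreePairCases (motive := fun i j _ => G.Walk (x i) (x j)) A D.reverse B i j h).edges
          → _) ?_ ?_ ?_ i j h
      · exact Or.inl
      · exact fun h => Or.inr (Or.inr (by simpa [finThreePairCases] using h))
      · exact fun h => Or.inr (Or.inl h)
  · refine finThreePairCases (finThreePairCases ?_ ?_ ?_) (finThreePairCases ?_ ?_ ?_)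
      (finThreePairCases ?_ ?_ ?_) <;> intro hne z hz hz' <;>
      simp only [finThreePairCases, hDr] at hz hz' <;> grind

/-- Three vertices of a cycle split it into three arcs. -/
theorem exists_arcs {G : SimpleGraph V} {x : Fin 3 → V} (hx : Function.Injective x)
    {a : V} {p : G.Walk a a} (hp : p.IsCycle) (hxp : ∀ i, x i ∈ p.support) :
    ∃ Q : ∀ i j : Fin 3, i < j → G.Walk (x i) (x j), (∀ i j h, (Q i j h).IsPath) ∧
      (∀ e, e ∈ p.edges ↔ ∃ i j h, e ∈ (Q i j h).edges) ∧
      ∀ i j h k l h', (i, j) ≠ (k, l) → ∀ z ∈ (Q i j h).support, z ∈ (Q k l h').support →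
        (z = x i ∨ z = x j) ∧ (z = x k ∨ z = x l) := by
  classical
  let q := p.rotate _ (hxp 0)
  have hq : q.IsCycle := hp.rotate (hxp 0)
  have hpq : ∀ e, e ∈ p.edges ↔ e ∈ q.edges := fun e => ((p.rotate_edges _ (hxp 0)).mem_iff).symm
  have h1 : x 1 ∈ q.support := (Walk.mem_support_rotate_iff _ _ _).2 (hxp 1)
  have h2 : x 2 ∈ q.support := (Walk.mem_support_rotate_iff _ _ _).2 (hxp 2)
  simp only [hpq]
  clear_value q
  have hspec := q.take_spec h1
  rw [← hspec, Walk.mem_support_append_iff] at h2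
  rcases h2 with h2 | h2
  · have hr : ((q.dropUntil _ h1).reverse.append (((q.takeUntil _ h1).dropUntil _ h2).reverse.append
        ((q.takeUntil _ h1).takeUntil _ h2).reverse)) = q.reverse := by
      rw [← Walk.reverse_append, Walk.take_spec, ← Walk.reverse_append, Walk.take_spec]
    obtain ⟨Q, hQ⟩ := exists_pairwise_walks hx (hr ▸ hq.reverse)
    refine ⟨Q, hQ.1, fun e => ?_, hQ.2.2⟩
    rw [← hQ.2.1, hr]
    simp
  · have hr : ((q.takeUntil _ h1).append (((q.dropUntil _ h1).takeUntil _ h2).append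
        ((q.dropUntil _ h1).dropUntil _ h2))) = q := by
      rw [Walk.take_spec, Walk.take_spec]
    obtain ⟨Q, hQ⟩ := exists_pairwise_walks hx (hr ▸ hq)
    refine ⟨Q, hQ.1, fun e => ?_, hQ.2.2⟩
    rw [← hQ.2.1, hr]

/-- Case analysis on the pairs `i < j` in `Fin (n + 1)`, according to whether `i = 0`. -/
def finSuccPairCases {n : ℕ} {motive : ∀ p : Fin (n + 1) × Fin (n + 1), p.1 < p.2 → Sort*}
    (h0 : ∀ j : Fin n, motive (0, j.succ) j.succ_pos)
    (hs : ∀ i j (h : i < j), motive (i.succ, j.succ) (Fin.succ_lt_succ_iff.2 h)) :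
    ∀ p h, motive p h := fun p =>
  Fin.cases (motive := fun i => ∀ j h, motive (i, j) h)
    (fun j => Fin.cases (motive := fun j => ∀ h, motive (0, j) h)
      (fun h => absurd h (lt_irrefl _)) (fun j _ => h0 j) j)
    (fun i j => Fin.cases (motive := fun j => ∀ h, motive (i.succ, j) h)
      (fun h => absurd h (Fin.not_lt_zero _))
      (fun j h => hs i j (Fin.succ_lt_succ_iff.1 h)) j) p.1 p.2

theorem exists_isK4SubdivisionOn_cons {G : SimpleGraph V} {v : V} {x : Fin 3 → V}
    (hx : Function.Injective x) (hvx : ∀ i, x i ≠ v) {R : ∀ i, G.Walk v (x i)}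
    (hR : ∀ i, (R i).IsPath)
    (hRR : ∀ i j, i ≠ j → ∀ z ∈ (R i).support, z ∈ (R j).support → z = v)
    {Q : ∀ i j : Fin 3, i < j → G.Walk (x i) (x j)} (hQ : ∀ i j h, (Q i j h).IsPath)
    (hQQ : ∀ i j h k l h', (i, j) ≠ (k, l) → ∀ z ∈ (Q i j h).support, z ∈ (Q k l h').support →
        (z = x i ∨ z = x j) ∧ (z = x k ∨ z = x l))
    (hRQ : ∀ i j k h, ∀ z ∈ (R i).support, z ∈ (Q j k h).support →
        z = x i ∧ (z = x j ∨ z = x k)) :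
    ∃ H : G.Subgraph, IsK4SubdivisionOn H (Fin.cons v x) ∧
      ∀ e, e ∈ H.edgeSet ↔ (∃ i, e ∈ (R i).edges) ∨ ∃ i j h, e ∈ (Q i j h).edges := by
  let P : ∀ p : Fin 4 × Fin 4, p.1 < p.2 → G.Walk ((Fin.cons v x : Fin 4 → V) p.1)
      ((Fin.cons v x : Fin 4 → V) p.2) := finSuccPairCases R Q
  have hb : Function.Injective (Fin.cons v x : Fin 4 → V) :=
    Fin.cons_injective_iff.2 ⟨by rintro ⟨i, h⟩; exact hvx i h, hx⟩
  refine ⟨_, ⟨hb, P, finSuccPairCases hR hQ, fun p h => ?_, rfl, ?_⟩, fun e => ?_⟩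
  · rw [pos_iff_ne_zero]
    exact fun h0 => h.ne (hb (Walk.eq_of_length_eq_zero h0))
  · suffices H : ∀ p hp q hq, p ≠ q → ∀ z, z ∈ (P p hp).support → z ∈ (P q hq).support → z ∈
        ({(Fin.cons v x : Fin 4 → V) p.1, (Fin.cons v x : Fin 4 → V) p.2} ∩
          {(Fin.cons v x : Fin 4 → V) q.1, (Fin.cons v x : Fin 4 → V) q.2} : Set V) from
      fun p q hp hq => H p hp q hq
    refine finSuccPairCases (fun i => finSuccPairCases (fun j => ?_) fun j k h => ?_)
      fun j k h => finSuccPairCases (fun i => ?_) fun l m h' => ?_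
    · intro hne z hz hz'
      exact ⟨.inl (hRR i j (fun h => hne (by rw [h])) z hz hz'),
        .inl (hRR i j (fun h => hne (by rw [h])) z hz hz')⟩
    · intro _ z hz hz'
      exact ⟨.inr (hRQ i j k h z hz hz').1, (hRQ i j k h z hz hz').2⟩
    · intro _ z hz hz'
      exact ⟨(hRQ i j k h z hz' hz).2, .inr (hRQ i j k h z hz' hz).1⟩
    · intro hne z hz hz'
      exact hQQ j k h l m h' (by simpa using hne) z hz hz'
  · simp only [Subgraph.edgeSet_iSup, Set.mem_iUnion, Walk.mem_edges_toSubgraph]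
    constructor
    · rintro ⟨p, h, he⟩
      exact finSuccPairCases (motive := fun p h => e ∈ (P p h).edges → _)
        (fun i he => .inl ⟨i, he⟩) (fun i j h he => .inr ⟨i, j, h, he⟩) p h he
    · rintro (⟨i, he⟩ | ⟨i, j, h, he⟩)
      · exact ⟨(0, i.succ), i.succ_pos, he⟩
      · exact ⟨(i.succ, j.succ), Fin.succ_lt_succ_iff.2 h, he⟩

theorem IsK4SubdivisionOn.exists_neighborSet_eq_pair {G : SimpleGraph V} {H : G.Subgraph}
    {b : Fin 4 → V} (hH : IsK4SubdivisionOn H b) {x y : V} (hx : x ∉ Set.range b)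
    (hxy : H.Adj x y) : ∃ s t, s ≠ t ∧ H.neighborSet x = {s, t} := by
  obtain ⟨hb, P, hP, -, rfl, hPP⟩ := hH
  have hadj : ∀ z, (⨆ (p : Fin 4 × Fin 4) (h : p.1 < p.2), (P p h).toSubgraph).Adj x z ↔
      ∃ p h, (P p h).toSubgraph.Adj x z := by simp
  obtain ⟨p, hp, hpy⟩ := (hadj y).1 hxy
  have hxp : x ∈ (P p hp).support := by
    rw [← Walk.mem_verts_toSubgraph]
    exact hpy.fst_mem
  obtain ⟨k, hk, hkl⟩ := Walk.mem_support_iff_exists_getVert.1 hxp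
  have hk0 : k ≠ 0 := by
    rintro rfl
    rw [Walk.getVert_zero] at hk
    exact hx ⟨_, hk⟩
  have hkl' : k < (P p hp).length := by
    refine hkl.lt_of_ne ?_
    rintro rfl
    rw [Walk.getVert_length] at hk
    exact hx ⟨_, hk⟩
  have hN : (⨆ (p : Fin 4 × Fin 4) (h : p.1 < p.2), (P p h).toSubgraph).neighborSet x =
      (P p hp).toSubgraph.neighborSet x := by
    ext z
    rw [Subgraph.mem_neighborSet, Subgraph.mem_neighborSet, hadj]
    refine ⟨?_, fun h => ⟨p, hp, h⟩⟩
    rintro ⟨q, hq, h⟩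
    by_cases hpq : p = q
    · subst hpq
      exact h
    have hxq : x ∈ (P q hq).support := by
      rw [← Walk.mem_verts_toSubgraph]
      exact h.fst_mem
    rcases (hPP p q hp hq hpq x hxp hxq).1 with h | h
    · exact absurd ⟨_, h.symm⟩ hx
    · exact absurd ⟨_, (Set.mem_singleton_iff.1 h).symm⟩ hx
  have h2 := (hP p hp).ncard_neighborSet_toSubgraph_internal_eq_two hk0 hkl'
  rw [hk, ← hN, Set.ncard_eq_two] at h2
  exact h2

theorem IsK4SubdivisionOn.apply_zero_mem_range {G : SimpleGraph V} {H : G.Subgraph}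
    {b b' : Fin 4 → V} (hH : IsK4SubdivisionOn H b) (hH' : IsK4SubdivisionOn H b') :
    b 0 ∈ Set.range b' := by
  by_contra hb'
  have hb := hH.1
  obtain ⟨-, P, hP, hlen, hHP, hPP⟩ := id hH
  have hpos : ∀ j : Fin 3, ((0, j.succ) : Fin 4 × Fin 4).1 < ((0, j.succ) : Fin 4 × Fin 4).2 :=
    fun j => j.succ_pos
  let y : Fin 3 → V := fun j => (P (0, j.succ) (hpos j)).snd
  have hnil : ∀ j, ¬ (P (0, j.succ) (hpos j)).Nil := fun j h =>
    (hlen _ (hpos j)).ne' (Walk.length_eq_zero_iff.2 h)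
  have hy : ∀ j, H.Adj (b 0) (y j) := by
    intro j
    rw [hHP, Subgraph.iSup_adj]
    refine ⟨(0, j.succ), ?_⟩
    rw [Subgraph.iSup_adj]
    exact ⟨hpos j, (P (0, j.succ) (hpos j)).toSubgraph_adj_snd (hnil j)⟩
  have hyinj : Function.Injective y := by
    intro i j hij
    by_contra hne
    have := hPP (0, i.succ) (0, j.succ) (hpos i) (hpos j) (by simpa using hne) (y i)
      (Walk.getVert_mem_support _ _) (by rw [hij]; exact Walk.getVert_mem_support _ _)
    have hy0 := (hy i).ne
    have hij' : b i.succ ≠ b j.succ := fun h => hne (Fin.succ_injective _ (hb h))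
    simp only [Set.mem_inter_iff, Set.mem_insert_iff, Set.mem_singleton_iff] at this
    grind
  obtain ⟨s, t, -, hst⟩ := hH'.exists_neighborSet_eq_pair hb' (hy 0)
  have hmem : ∀ j, y j = s ∨ y j = t := by
    intro j
    have : y j ∈ H.neighborSet (b 0) := hy j
    rw [hst] at this
    simpa using this
  have h01 : y 0 ≠ y 1 := fun h => by cases hyinj h
  have h12 : y 1 ≠ y 2 := fun h => by cases hyinj h
  have h20 : y 2 ≠ y 0 := fun h => by cases hyinj h
  have h0 := hmem 0
  have h1 := hmem 1
  have h2 := hmem 2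
  grind

theorem IsK4SubdivisionOn.apply_eq_apply [Fintype V] {G : SimpleGraph V} {H : G.Subgraph}
    {b : Fin 4 → V} (hH : IsK4SubdivisionOn H b) {w : Sym2 V → ZMod 2}
    (hw : ∀ e, w e ≠ 0 → e ∈ H.edgeSet) {x y z : V} (hx : x ∉ Set.range b)
    (hsum : ∑ y, w s(x, y) = 0) (hxy : H.Adj x y) (hxz : H.Adj x z) : w s(x, y) = w s(x, z) := by
  classical
  obtain ⟨s, t, hne, hst⟩ := hH.exists_neighborSet_eq_pair hx hxy
  have hs : w s(x, s) = w s(x, t) := by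
    rw [Finset.sum_eq_add s t hne ?_ (by simp) (by simp)] at hsum
    · exact CharTwo.add_eq_zero.1 hsum
    · intro u _ hu
      by_contra h
      have : u ∈ H.neighborSet x := hw _ h
      rw [hst] at this
      simp [hu.1, hu.2] at this
  have h1 : y ∈ H.neighborSet x := hxy
  have h2 : z ∈ H.neighborSet x := hxz
  rw [hst] at h1 h2
  rcases h1 with rfl | rfl <;> rcases h2 with rfl | rfl <;> simp [hs]

theorem IsK4SubdivisionOn.apply_eq_zero_of_mem_edges [Fintype V] {G : SimpleGraph V}
    {H : G.Subgraph} {b : Fin 4 → V} (hH : IsK4SubdivisionOn H b) {w : Sym2 V → ZMod 2}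
    (hw : ∀ e, w e ≠ 0 → e ∈ H.edgeSet) (hsum : ∀ x, ∑ y, w s(x, y) = 0)
    {u t : V} {R : G.Walk u t} (hR : R.IsPath) (hRH : ∀ e ∈ R.edges, e ∈ H.edgeSet)
    (hRb : ∀ x ∈ R.support, x ∈ Set.range b → x = u ∨ x = t) (hu : ∀ x, w s(u, x) = 0) :
    ∀ e ∈ R.edges, w e = 0 := by
  have hadj : ∀ k < R.length, H.Adj (R.getVert k) (R.getVert (k + 1)) := by
    intro k hk
    refine Subgraph.mem_edgeSet.1 (hRH _ ?_)
    rw [← Walk.mem_edges_toSubgraph]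
    exact R.toSubgraph_adj_getVert hk
  have hzero : ∀ k < R.length, w s(R.getVert k, R.getVert (k + 1)) = 0 := by
    intro k
    induction k with
    | zero => simp [hu]
    | succ k ih =>
      intro hk
      rw [← ih (by omega), Sym2.eq_swap (a := R.getVert k)]
      refine hH.apply_eq_apply hw ?_ (hsum _) (hadj _ hk) (hadj k (by omega)).symm
      intro h
      rcases hRb _ (R.getVert_mem_support _) h with h | h
      · rw [hR.getVert_eq_start_iff (by omega)] at h
        omega
      · rw [hR.getVert_eq_end_iff (by omega)] at h
        omega
  intro e he
  induction e with
  | _ x y =>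
    rw [← Walk.mem_edges_toSubgraph] at he
    obtain ⟨k, hk, hkl⟩ := (Walk.toSubgraph_adj_iff _).1 he
    rw [← hk]
    exact hzero k hkl

theorem not_adj_deleteIncidenceSet (G : SimpleGraph V) (v x : V) :
    ¬ (G.deleteIncidenceSet v).Adj v x := fun h =>
  (deleteIncidenceSet_adj.1 h).2.1 rfl

/-- A circuit of the cycle space of `G - v` extends to a `K₄`-subdivision with branch vertex `v`
that contains no other cycle avoiding `v`. -/
theorem exists_isK4SubdivisionOn_of_isCircuitOf [Fintype V] {G : SimpleGraph V}
    (hG : IsKConnected 3 G) {v : V} {c : Sym2 V → ZMod 2}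
    (hc : IsCircuitOf (cycleSpace (G.deleteIncidenceSet v)) c) :
    ∃ (H : G.Subgraph) (b : Fin 4 → V), IsK4SubdivisionOn H b ∧ b 0 = v ∧
      (∀ e, c e ≠ 0 → e ∈ H.edgeSet) ∧
      ∀ w ∈ cycleSpace (G.deleteIncidenceSet v), w ≠ 0 → (∀ e, w e ≠ 0 → e ∈ H.edgeSet) →
        w = c := by
  classical
  obtain ⟨a, p, hp, hpc⟩ := exists_isCycle_of_isCircuitOf hc
  have hle := G.deleteIncidenceSet_le v
  have hiso := not_adj_deleteIncidenceSet G v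
  have hvp : v ∉ p.support := by
    intro h
    obtain ⟨e, he, hve⟩ := (Walk.mem_support_iff_exists_mem_edges_of_not_nil hp.not_nil).1 h
    obtain ⟨y, rfl⟩ := Sym2.mem_iff_exists.1 hve
    exact hiso y (p.adj_of_mem_edges he)
  have hX : 3 ≤ p.support.toFinset.card := by
    have hlen := hp.three_le_length
    rw [← Nat.add_sub_cancel (n := p.length) (m := 1), ← Walk.length_support,
      ← List.length_tail, ← List.toFinset_card_of_nodup hp.support_nodup] at hlen
    exact hlen.trans (Finset.card_le_card fun y hy =>
      List.mem_toFinset.2 (List.mem_of_mem_tail (List.mem_toFinset.1 hy)))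
  obtain ⟨x, R, hxX, hR, hRX, hRR⟩ := exists_fan hG (by simpa using hvp) hX
  simp only [List.mem_toFinset] at hxX hRX
  have hxv : ∀ i, x i ≠ v := fun i h => hvp (h ▸ hxX i)
  have hx : Function.Injective x := by
    intro i j hij
    by_contra hne
    exact hxv i (hRR i j hne _ (R i).end_mem_support (by rw [hij]; exact (R j).end_mem_support))
  obtain ⟨Q, hQ, hpQ, hQQ⟩ := exists_arcs hx hp hxX
  have hQsub : ∀ i j h, ∀ z ∈ (Q i j h).support, z ∈ p.support := by
    intro i j h z hz
    have hnil : ¬ (Q i j h).Nil := fun hn => h.ne (hx hn.eq)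
    obtain ⟨e, he, hze⟩ := (Walk.mem_support_iff_exists_mem_edges_of_not_nil hnil).1 hz
    obtain ⟨y, rfl⟩ := Sym2.mem_iff_exists.1 hze
    exact p.fst_mem_support_of_mem_edges ((hpQ _).2 ⟨i, j, h, he⟩)
  have hQx : ∀ i j h k, x k ∈ (Q i j h).support → x k = x i ∨ x k = x j := by
    intro i j h k hk
    by_contra! hne
    have hki : k ≠ i := fun h => hne.1 (h ▸ rfl)
    have hkj : k ≠ j := fun h => hne.2 (h ▸ rfl)
    rcases lt_or_gt_of_ne hki with h' | h'
    · have := (hQQ i j h k i h' (by simp [hki.symm]) _ hk (Q k i h').start_mem_support).1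
      tauto
    · have := (hQQ i j h i k h' (by simp [hkj.symm]) _ hk (Q i k h').end_mem_support).1
      tauto
  obtain ⟨H, hH, hHe⟩ := exists_isK4SubdivisionOn_cons hx hxv hR hRR
    (Q := fun i j h => (Q i j h).mapLe hle) (fun i j h => (hQ i j h).mapLe hle)
    (by simpa using hQQ) (by
      intro i j k h z hz hz'
      rw [Walk.support_mapLe_eq_support] at hz'
      obtain rfl := hRX i z hz (hQsub j k h z hz')
      exact ⟨rfl, hQx j k h i hz'⟩)
  simp only [Walk.edges_mapLe_eq_edges, ← hpQ] at hHe
  refine ⟨H, _, hH, rfl, fun e he => (hHe e).2 (.inr ((hpc e).1 he)), fun w hw hw0 hwH => ?_⟩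
  refine hc.2.2 w hw hw0 fun e hce => ?_
  by_contra hwe
  rcases (hHe e).1 (hwH e hwe) with ⟨i, he⟩ | he
  · refine hwe (hH.apply_eq_zero_of_mem_edges hwH hw.2 (hR i)
      (fun e he => (hHe e).2 (.inl ⟨i, he⟩)) ?_ (fun y => hw.1 _ (hiso y)) e he)
    intro y hy hyb
    rw [Fin.range_cons] at hyb
    rcases hyb with rfl | ⟨j, rfl⟩
    · exact .inl rfl
    · exact .inr (hRX i _ hy (hxX j))
  · exact (hpc e).2 he hce

/-- A `K₄`-subdivision arises from at most one circuit for each of its four branch vertices. -/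
theorem sum_ncard_isCircuitOf_le [Fintype V] {G : SimpleGraph V} (hG : IsKConnected 3 G) :
    ∑ v, {c | IsCircuitOf (cycleSpace (G.deleteIncidenceSet v)) c}.ncard ≤
      4 * {H : G.Subgraph | IsK4Subdivision H}.ncard := by
  classical
  choose H b hHb hb0 hcH huniq using fun (v : V) (c : Sym2 V → ZMod 2)
    (hc : IsCircuitOf (cycleSpace (G.deleteIncidenceSet v)) c) =>
      exists_isK4SubdivisionOn_of_isCircuitOf hG hc
  choose b' hb' using fun H : {H : G.Subgraph | IsK4Subdivision H} => H.2
  have hidx : ∀ v c hc, ∃ i, b' ⟨H v c hc, _, hHb v c hc⟩ i = v := by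
    intro v c hc
    have := (hHb v c hc).apply_zero_mem_range (hb' ⟨H v c hc, _, hHb v c hc⟩)
    rwa [hb0] at this
  choose i hi using hidx
  let F : (Σ v : V, {c | IsCircuitOf (cycleSpace (G.deleteIncidenceSet v)) c}) →
      Fin 4 × {H : G.Subgraph | IsK4Subdivision H} :=
    fun s => (i s.1 s.2.1 s.2.2, ⟨H s.1 s.2.1 s.2.2, _, hHb s.1 s.2.1 s.2.2⟩)
  have hF : Function.Injective F := by
    rintro ⟨v, c, hc⟩ ⟨u, d, hd⟩ h
    simp only [F, Prod.mk.injEq] at h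
    have huv : v = u := by
      rw [← hi v c hc, ← hi u d hd, h.1, h.2]
    subst huv
    have hHH : H v c hc = H v d hd := congrArg Subtype.val h.2
    have : c = d := huniq v d hd c hc.1 hc.2.1 fun e he => hHH ▸ hcH v c hc e he
    subst this
    rfl
  have := Nat.card_le_card_of_injective F hF
  rw [Nat.card_prod, Nat.card_sigma, Nat.card_fin] at this
  simpa only [Nat.card_coe_set_eq] using this

theorem choose_two_le_ncard_isCircuitOf_deleteIncidenceSet [Fintype V] {G : SimpleGraph V}
    [DecidableRel G.Adj] (hG : IsKConnected 3 G) (v : V) :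
    (G.edgeSet.ncard + 3 - G.degree v - Fintype.card V).choose 2 ≤
      {c | IsCircuitOf (cycleSpace (G.deleteIncidenceSet v)) c}.ncard := by
  classical
  have hiso := not_adj_deleteIncidenceSet G v
  have h1 : ((G.deleteIncidenceSet v).induce {v}ᶜ).Connected := by
    have := hG.2 {v} (by simp)
    rw [Finset.coe_singleton] at this
    rwa [G.induce_deleteIncidenceSet_of_notMem (by simp)]
  have h2 : ∀ w, w ≠ v → ((G.deleteIncidenceSet v).induce {v, w}ᶜ).Connected := by
    intro w _
    have := hG.2 {v, w} (Finset.card_le_two.trans_lt (by simp))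
    rw [Finset.coe_pair] at this
    rwa [G.induce_deleteIncidenceSet_of_notMem (by simp)]
  obtain ⟨u, hu⟩ : ∃ u, u ≠ v := by
    have : Nontrivial V := Fintype.one_lt_card_iff_nontrivial.1 (by have := hG.1; omega)
    exact exists_ne v
  refine (Nat.choose_le_choose 2 ?_).trans
    (choose_two_le_ncard_isCircuitOf (indecomposable_cycleSpace hiso h1 h2))
  have hcard := card_edgeFinset_le_finrank_cycleSpace_add (G.deleteIncidenceSet v) hu hiso
  rw [card_edgeFinset_deleteIncidenceSet] at hcard
  rw [← coe_edgeFinset, Set.ncard_coe_finset]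
  omega

/-- A 3-connected graph with `n` vertices, `m` edges and vertex degrees
`d v` contains at least `(1/4) ∑_v binom(m - d v - n + 3, 2)` distinct `K₄`-subdivisions. -/
theorem stmt9 [Fintype V] {G : SimpleGraph V} [DecidableRel G.Adj]
    (hG : IsKConnected 3 G) :
    (1 / 4 : ℝ) * ∑ v : V,
        ((G.edgeSet.ncard + 3 - G.degree v - Fintype.card V).choose 2 : ℝ) ≤
      ({H : G.Subgraph | IsK4Subdivision H}.ncard : ℝ) := by
  have h := (Finset.sum_le_sum fun v _ =>
    choose_two_le_ncard_isCircuitOf_deleteIncidenceSet hG v).trans (sum_ncard_isCircuitOf_le hG)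
  have h' : (∑ v : V, ((G.edgeSet.ncard + 3 - G.degree v - Fintype.card V).choose 2 : ℝ)) ≤
      4 * ({H : G.Subgraph | IsK4Subdivision H}.ncard : ℝ) := by
    exact_mod_cast h
  linarith
end
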